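/- Let (Σ_r, σ_r) be a topological Markov flow with Hölder roof function r satisfying 0 < inf r ≤ sup r < ∞, and let ϑ be a Hölder continuous potential on Σ_r with finite top pressure. Then (Σ_r, σ_r) is strongly positively recurrent (SPR) for ϑ if and only if the base shift (Σ, σ) is SPR for the induced potential Δ_ϑ − P_TOP(σ_r, ϑ)·r, where Δ_ϑ(x) = ∫₀^{r(x)} ϑ(x,s) ds. -/

import Mathlib

open MeasureTheory Set
open scoped ENNReal

/-- A directed graph (edge relation `A`) is proper if every vertex has positive
ingoing and outgoing degree. -/
def IsProperGraph {V : Type*} (A : V → V → Prop) : Prop :=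
  ∀ v : V, (∃ u, A u v) ∧ (∃ w, A v w)

/-- The (two-sided) topological Markov shift determined by the graph `A`. -/
def TMS {V : Type*} (A : V → V → Prop) : Type _ :=
  {x : ℤ → V // ∀ i : ℤ, A (x i) (x (i + 1))}

namespace TMS

variable {V : Type*} {A : V → V → Prop}

/-- The topology of the TMS: the product of the discrete topology on the vertices
(the topology of the metric `d(x,y) = exp (-min {|n| : x_n ≠ y_n})`). -/
instance : TopologicalSpace (TMS A) :=
  TopologicalSpace.induced (fun x => (x.val : ℤ → V))
    (@Pi.topologicalSpace ℤ (fun _ => V) (fun _ => ⊥))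

/-- The Borel σ-algebra of the TMS: the product σ-algebra of the discrete one. -/
instance : MeasurableSpace (TMS A) :=
  MeasurableSpace.comap (fun x => (x.val : ℤ → V))
    (@MeasurableSpace.pi ℤ (fun _ => V) (fun _ => ⊤))

/-- The left shift `σ` on a topological Markov shift. -/
def shift (x : TMS A) : TMS A :=
  ⟨fun i => x.val (i + 1), fun i => x.prop (i + 1)⟩

end TMS

/-- A finite measurable partition of `X`. -/
def IsFinMeasPartition {X : Type*} [MeasurableSpace X] {k : ℕ} (P : Fin k → Set X) : Prop :=
  (∀ i, MeasurableSet (P i)) ∧ (∀ i j, i ≠ j → Disjoint (P i) (P j)) ∧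
    (⋃ i, P i) = Set.univ

/-- The entropy of the refinement `P ∨ T⁻¹P ∨ ⋯ ∨ T^{-(n-1)}P` with respect to `μ`. -/
noncomputable def dynRefinedEntropy {X : Type*} [MeasurableSpace X]
    (μ : Measure X) (T : X → X) {k : ℕ} (P : Fin k → Set X) (n : ℕ) : ℝ :=
  ∑ f : Fin n → Fin k,
    Real.negMulLog ((μ (⋂ i : Fin n, T^[(i : ℕ)] ⁻¹' P (f i))).toReal)

/-- The dynamical entropy of `T` relative to the finite partition `P`
(by subadditivity the defining limit equals the infimum). -/
noncomputable def entropyAlongPartition {X : Type*} [MeasurableSpace X]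
    (μ : Measure X) (T : X → X) {k : ℕ} (P : Fin k → Set X) : ℝ :=
  ⨅ n : ℕ, dynRefinedEntropy μ T P (n + 1) / ((n : ℝ) + 1)

/-- The Kolmogorov–Sinai (metric) entropy `h_μ(T)`: the supremum over all finite
measurable partitions of the dynamical entropy along the partition. -/
noncomputable def kolSinaiEntropy {X : Type*} [MeasurableSpace X]
    (μ : Measure X) (T : X → X) : ℝ≥0∞ :=
  ⨆ (k : ℕ) (P : Fin k → Set X) (_ : IsFinMeasPartition P),
    ENNReal.ofReal (entropyAlongPartition μ T P)

/-- Birkhoff sums `r_n = r + r ∘ T + ⋯ + r ∘ T^{n-1}`. -/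
def birkhoff {X : Type*} (T : X → X) (r : X → ℝ) : ℕ → X → ℝ
  | 0, _ => 0
  | n + 1, x => r x + birkhoff T r n (T x)

/-- The suspension space `Σ_r = {(x,t) : 0 ≤ t < r x}` over a roof function `r`. -/
abbrev Susp {X : Type*} (r : X → ℝ) : Type _ :=
  {p : X × ℝ // 0 ≤ p.2 ∧ p.2 < r p.1}

/-- The probability measure on the suspension space induced by a measure `μ` on the
base: the normalized restriction of `μ ⊗ Leb` to the region below the roof. -/
noncomputable def suspensionMeasure {X : Type*} [MeasurableSpace X]
    (μ : Measure X) (r : X → ℝ) : Measure (Susp r) :=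
  (ENNReal.ofReal (∫ x, r x ∂μ))⁻¹ •
    Measure.comap (Subtype.val : Susp r → X × ℝ) (μ.prod volume)

/-- Metric pressure `P_μ(T, g) = h_μ(T) + ∫ g dμ` (real-valued). -/
noncomputable def realPressure {X : Type*} [MeasurableSpace X]
    (μ : Measure X) (T : X → X) (g : X → ℝ) : ℝ :=
  (kolSinaiEntropy μ T).toReal + ∫ x, g x ∂μ

/-- The set of metric pressures of `T`-invariant probability measures. -/
def pressureSetMap {X : Type*} [MeasurableSpace X] (T : X → X) (g : X → ℝ) : Set ℝ :=
  {p : ℝ | ∃ μ : Measure X, IsProbabilityMeasure μ ∧ MeasurePreserving T μ μ ∧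
    p = realPressure μ T g}

/-- The top pressure `P_TOP(T, g)`, the supremum of the metric pressures. -/
noncomputable def topPressureMap {X : Type*} [MeasurableSpace X] (T : X → X) (g : X → ℝ) : ℝ :=
  sSup (pressureSetMap T g)

/-- The Gurevich entropy of `T`: the supremum of the metric entropies of the
`T`-invariant probability measures. -/
noncomputable def gurevichEntropyMap {X : Type*} [MeasurableSpace X] (T : X → X) : ℝ≥0∞ :=
  ⨆ (μ : Measure X) (_ : IsProbabilityMeasure μ) (_ : MeasurePreserving T μ μ),
    kolSinaiEntropy μ T

/-- A measure is invariant for the flow `Φ`. -/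
def FlowInvariant {S : Type*} [MeasurableSpace S] (Φ : ℝ → S → S) (μ : Measure S) : Prop :=
  ∀ t : ℝ, MeasurePreserving (Φ t) μ μ

/-- A measure is ergodic for the flow `Φ`. -/
def FlowErgodic {S : Type*} [MeasurableSpace S] (Φ : ℝ → S → S) (μ : Measure S) : Prop :=
  FlowInvariant Φ μ ∧
    ∀ s : Set S, MeasurableSet s → (∀ t, Φ t ⁻¹' s = s) → μ s = 0 ∨ μ s = 1

/-- Metric pressure of a measure for a flow: entropy of the time-one map plus `∫ g`. -/
noncomputable def flowRealPressure {S : Type*} [MeasurableSpace S]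
    (Φ : ℝ → S → S) (μ : Measure S) (g : S → ℝ) : ℝ :=
  (kolSinaiEntropy μ (Φ 1)).toReal + ∫ x, g x ∂μ

/-- The set of metric pressures of flow-invariant probability measures. -/
def flowPressureSet {S : Type*} [MeasurableSpace S] (Φ : ℝ → S → S) (g : S → ℝ) : Set ℝ :=
  {p : ℝ | ∃ μ : Measure S, IsProbabilityMeasure μ ∧ FlowInvariant Φ μ ∧
    p = flowRealPressure Φ μ g}

/-- The top pressure `P_TOP(Φ, g)` of a flow. -/
noncomputable def flowTopPressure {S : Type*} [MeasurableSpace S]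
    (Φ : ℝ → S → S) (g : S → ℝ) : ℝ :=
  sSup (flowPressureSet Φ g)

/-- The Gurevich entropy of a flow. -/
noncomputable def flowGurevichEntropy {S : Type*} [MeasurableSpace S] (Φ : ℝ → S → S) : ℝ≥0∞ :=
  ⨆ (μ : Measure S) (_ : IsProbabilityMeasure μ) (_ : FlowInvariant Φ μ),
    kolSinaiEntropy μ (Φ 1)

/-- Hölder continuity with respect to the standard metric
`d(x,y) = exp (-min {|n| : x_n ≠ y_n})` on a two-sided TMS. -/
def TMSHolder {V : Type*} {A : V → V → Prop} (g : TMS A → ℝ) : Prop :=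
  ∃ K β : ℝ, 0 < β ∧ ∀ (N : ℕ) (x y : TMS A),
    (∀ i : ℤ, |i| ≤ (N : ℤ) → x.val i = y.val i) →
    |g x - g y| ≤ K * Real.exp (-(β * ((N : ℝ) + 1)))

/-- A cylinder `{x : x_{m+i} = w_i, 0 ≤ i ≤ n}` in a TMS. -/
def IsCylinder {V : Type*} {A : V → V → Prop} (s : Set (TMS A)) : Prop :=
  ∃ (m : ℤ) (n : ℕ) (w : Fin (n + 1) → V),
    s = {x : TMS A | ∀ i : Fin (n + 1), x.val (m + ((i : ℕ) : ℤ)) = w i}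

/-- A finite union of cylinders in a TMS. -/
def IsFinUnionOfCylinders {V : Type*} {A : V → V → Prop} (s : Set (TMS A)) : Prop :=
  ∃ (k : ℕ) (c : Fin k → Set (TMS A)), (∀ i, IsCylinder (c i)) ∧ s = ⋃ i, c i

/-- The TMS `(Σ, σ)` is strongly positively recurrent (SPR) for the potential `g`:
it has finite Gurevich entropy and there are a finite union of cylinders `C`, numbers
`P₀ < P_TOP(σ, g)` and `τ > 0` such that `ν C > τ` for every ergodic `σ`-invariant
probability measure `ν` with `P_ν(σ, g) > P₀`. -/
def TMSisSPRFor {V : Type*} (A : V → V → Prop) (g : TMS A → ℝ) : Prop :=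
  gurevichEntropyMap (TMS.shift : TMS A → TMS A) ≠ ⊤ ∧
  ∃ Cs : Set (TMS A), IsFinUnionOfCylinders Cs ∧
    ∃ P₀ τ : ℝ, P₀ < topPressureMap (TMS.shift : TMS A → TMS A) g ∧ 0 < τ ∧
      ∀ ν : Measure (TMS A), IsProbabilityMeasure ν → Ergodic TMS.shift ν →
        P₀ < realPressure ν TMS.shift g → ENNReal.ofReal τ < ν Cs

/-- The suspension flow `(Σ_r, σ_r)` is SPR for the potential `g` on `Σ_r`:
it has finite Gurevich entropy and there are a finite union of cylinders `C` on the
base `Σ`, numbers `P₀ < P_TOP(σ_r, g)` and `τ > 0` such that the suspension of `C`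
has `ν`-measure `> τ` for every ergodic `σ_r`-invariant probability `ν` with
`P_ν(σ_r, g) > P₀`. -/
def FlowSPRFor {V : Type*} {A : V → V → Prop} (r : TMS A → ℝ)
    (Φ : ℝ → Susp r → Susp r) (g : Susp r → ℝ) : Prop :=
  flowGurevichEntropy Φ ≠ ⊤ ∧
  ∃ Cs : Set (TMS A), IsFinUnionOfCylinders Cs ∧
    ∃ P₀ τ : ℝ, P₀ < flowTopPressure Φ g ∧ 0 < τ ∧
      ∀ ν : Measure (Susp r), IsProbabilityMeasure ν → FlowErgodic Φ ν →
        P₀ < flowRealPressure Φ ν g →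
        ENNReal.ofReal τ < ν {q : Susp r | q.val.1 ∈ Cs}

set_option linter.unusedSectionVars false
set_option linter.unusedVariables false

namespace Abr

variable {X : Type*} [MeasurableSpace X]

/-- Finite-label measurability. -/
def FM {ι : Type} (f : X → ι) : Prop := ∀ i, MeasurableSet (f ⁻¹' {i})

/-- Entropy of a finite-label function with respect to a (finite) measure. -/
noncomputable def H {ι : Type} [Fintype ι] (m : Measure X) (f : X → ι) : ℝ :=
  ∑ i, Real.negMulLog (m.real (f ⁻¹' {i}))

/-- Pairing of label functions. -/
def pr {ι κ : Type} (f : X → ι) (g : X → κ) : X → ι × κ := fun x => (f x, g x)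

/-- Conditional entropy. -/
noncomputable def cH {ι κ : Type} [Fintype ι] [Fintype κ] (m : Measure X) (f : X → ι)
    (g : X → κ) : ℝ := H m (pr f g) - H m g

variable {ι κ l : Type} [Fintype ι] [Fintype κ] [Fintype l]

lemma pr_pre (f : X → ι) (g : X → κ) (p : ι × κ) :
    pr f g ⁻¹' {p} = f ⁻¹' {p.1} ∩ g ⁻¹' {p.2} := by
  ext x; simp [pr, Prod.ext_iff]

lemma FM.set {f : X → ι} (hf : FM f) (s : Set ι) : MeasurableSet (f ⁻¹' s) := by
  have : f ⁻¹' s = ⋃ i ∈ s, f ⁻¹' {i} := by ext x; simp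
  rw [this]
  exact MeasurableSet.biUnion (Set.to_countable s) fun i _ => hf i

lemma FM.comp {f : X → ι} (hf : FM f) (φ : ι → κ) : FM (fun x => φ (f x)) := by
  intro i
  exact hf.set (φ ⁻¹' {i})

lemma FM.of_comp {Y : Type*} [MeasurableSpace Y] {f : X → ι} (hf : FM f) {T : Y → X}
    (hT : Measurable T) : FM (fun x => f (T x)) := fun i => hT (hf i)

lemma FM.pr {f : X → ι} {g : X → κ} (hf : FM f) (hg : FM g) : FM (Abr.pr f g) := by
  intro p
  rw [pr_pre]
  exact (hf _).inter (hg _)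

lemma FM.pi {a : Type} [Fintype a] {β : a → Type} {f : ∀ i, X → β i} (hf : ∀ i, FM (f i)) :
    FM (fun x i => f i x) := by
  intro p
  have : (fun x i => f i x) ⁻¹' {p} = ⋂ i, f i ⁻¹' {p i} := by
    ext x; simp [funext_iff]
  rw [this]
  exact MeasurableSet.iInter fun i => hf i _

lemma sum_real {m : Measure X} [IsFiniteMeasure m] {f : X → ι} (hf : FM f) {s : Set X}
    (hs : MeasurableSet s) :
    ∑ i, m.real (f ⁻¹' {i} ∩ s) = m.real s := by
  classical
  have h := measureReal_biUnion_finset (μ := m) (s := Finset.univ)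
    (f := fun i => f ⁻¹' {i} ∩ s) ?_ (fun i _ => (hf i).inter hs)
  · rw [← h]
    congr 1
    ext x; simp
  · intro i _ j _ hij
    rw [Function.onFun, Set.disjoint_left]
    rintro x ⟨h1, -⟩ ⟨h2, -⟩
    exact hij (h1.symm.trans h2)

lemma sum_real_right {m : Measure X} [IsFiniteMeasure m] {f : X → ι} (hf : FM f) {s : Set X}
    (hs : MeasurableSet s) :
    ∑ i, m.real (s ∩ f ⁻¹' {i}) = m.real s := by
  simp_rw [Set.inter_comm s]
  exact sum_real hf hs

lemma sum_real_univ {m : Measure X} [IsFiniteMeasure m] {f : X → ι} (hf : FM f) :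
    ∑ i, m.real (f ⁻¹' {i}) = m.real univ := by
  have := sum_real (m := m) hf MeasurableSet.univ
  simpa using this

lemma H_equiv (m : Measure X) (f : X → ι) (e : ι ≃ κ) :
    H m (fun x => e (f x)) = H m f := by
  unfold H
  refine (Fintype.sum_equiv e _ _ fun i => ?_).symm
  congr 2
  ext x; simp

lemma H_swap (m : Measure X) (f : X → ι) (g : X → κ) : H m (pr f g) = H m (pr g f) :=
  (H_equiv m (pr f g) (Equiv.prodComm ι κ)).symm

lemma H_assoc (m : Measure X) (f : X → ι) (g : X → κ) (h : X → l) :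
    H m (pr (pr f g) h) = H m (pr f (pr g h)) :=
  (H_equiv m (pr (pr f g) h) (Equiv.prodAssoc ι κ l)).symm

lemma H_pr (m : Measure X) (f : X → ι) (g : X → κ) :
    H m (pr f g) = ∑ i, ∑ j, Real.negMulLog (m.real (f ⁻¹' {i} ∩ g ⁻¹' {j})) := by
  unfold H
  rw [Fintype.sum_prod_type]
  simp_rw [pr_pre]

/-- `f` determines `g` up to a null set. -/
def Det {ι κ : Type} (m : Measure X) (f : X → ι) (g : X → κ) : Prop :=
  ∃ E : Set X, m Eᶜ = 0 ∧ ∀ x ∈ E, ∀ y ∈ E, f x = f y → g x = g y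

lemma Det.H_eq {m : Measure X} {f : X → ι} {g : X → κ} (h : Det m f g) :
    H m (pr f g) = H m f := by
  classical
  obtain ⟨E, hE, hd⟩ := h
  rw [H_pr, H]
  refine Finset.sum_congr rfl fun i _ => ?_
  have hnull : ∀ s : Set X, (∀ x ∈ s, x ∉ E) → m.real s = 0 := by
    intro s hs
    rw [measureReal_def, measure_mono_null (fun x hx => hs x hx) hE]; simp
  by_cases hex : ∃ y ∈ E, f y = i
  · obtain ⟨y, hyE, hy⟩ := hex
    rw [Finset.sum_eq_single (g y)]
    · congr 1
      rw [measureReal_def, measureReal_def]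
      congr 1
      apply measure_congr
      have : ∀ᵐ x ∂m, x ∈ E := hE
      filter_upwards [this] with x hx
      apply propext
      constructor
      · rintro ⟨h1, -⟩; exact h1
      · intro h1
        exact ⟨h1, hd x hx y hyE (h1.trans hy.symm)⟩
    · intro j _ hj
      rw [hnull, Real.negMulLog_zero]
      rintro x ⟨h1, h2⟩ hx
      exact hj (h2.symm.trans (hd x hx y hyE (h1.trans hy.symm)))
    · simp
  · push Not at hex
    rw [hnull (f ⁻¹' {i}) fun x hx hxE => hex x hxE hx, Real.negMulLog_zero]
    refine Finset.sum_eq_zero fun j _ => ?_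
    rw [hnull _ fun x hx hxE => hex x hxE hx.1, Real.negMulLog_zero]

lemma det_of {m : Measure X} {f : X → ι} {g : X → κ} (h : ∀ x y, f x = f y → g x = g y) :
    Det m f g := ⟨univ, by simp, fun x _ y _ => h x y⟩

lemma det_restrict {m : Measure X} {f : X → ι} {g : X → κ} {E : Set X} (hE : MeasurableSet E)
    (h : ∀ x ∈ E, ∀ y ∈ E, f x = f y → g x = g y) :
    Det (m.restrict E) f g :=
  ⟨E, by rw [Measure.restrict_apply hE.compl]; simp, h⟩

lemma Det.pr_left {m : Measure X} {f : X → ι} {g : X → κ} (h : Det m f g) (k : X → l) :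
    Det m (pr k f) (pr k g) := by
  obtain ⟨E, hE, hd⟩ := h
  refine ⟨E, hE, fun x hx y hy hxy => ?_⟩
  simp only [pr, Prod.mk.injEq] at hxy ⊢
  exact ⟨hxy.1, hd x hx y hy hxy.2⟩

/-- mutual determination gives equal entropy -/
lemma H_congr_det {m : Measure X} {f : X → ι} {g : X → κ} (h : Det m f g) (h' : Det m g f) :
    H m f = H m g := by
  rw [← h.H_eq, H_swap, h'.H_eq]

lemma H_le_pr {m : Measure X} [IsFiniteMeasure m] {f : X → ι} {g : X → κ}
    (hf : FM f) (hg : FM g) : H m f ≤ H m (pr f g) := by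
  rw [H_pr, H]
  refine Finset.sum_le_sum fun i _ => ?_
  rw [← sum_real_right (m := m) hg (hf i)]
  simp only [Real.negMulLog]
  rw [← Finset.sum_neg_distrib, Finset.sum_mul]
  refine Finset.sum_le_sum fun j _ => ?_
  rw [sum_real_right (m := m) hg (hf i)]
  set a := m.real (f ⁻¹' {i} ∩ g ⁻¹' {j})
  have ha : 0 ≤ a := measureReal_nonneg
  rcases ha.eq_or_lt with h0 | h0
  · rw [← h0]; simp
  have : a ≤ m.real (f ⁻¹' {i}) := measureReal_mono inter_subset_left
  have := Real.log_le_log h0 this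
  nlinarith

lemma H_le_of_det {m : Measure X} [IsFiniteMeasure m] {f : X → ι} {g : X → κ}
    (hf : FM f) (hg : FM g) (h : Det m g f) : H m f ≤ H m g := by
  rw [← h.H_eq, H_swap]
  exact H_le_pr hf hg

lemma cH_nonneg {m : Measure X} [IsFiniteMeasure m] {f : X → ι} {g : X → κ}
    (hf : FM f) (hg : FM g) : 0 ≤ cH m f g := by
  unfold cH
  rw [H_swap]
  linarith [H_le_pr (m := m) hg hf]

/-- strong subadditivity -/
lemma ssa {m : Measure X} [IsFiniteMeasure m] {f : X → ι} {g : X → κ} {h : X → l}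
    (hf : FM f) (hg : FM g) (hh : FM h) :
    H m (pr f (pr g h)) + H m h ≤ H m (pr f h) + H m (pr g h) := by
  classical
  set a : ι → κ → l → ℝ := fun i j k => m.real (f ⁻¹' {i} ∩ (g ⁻¹' {j} ∩ h ⁻¹' {k})) with hadef
  set b : ι → l → ℝ := fun i k => m.real (f ⁻¹' {i} ∩ h ⁻¹' {k}) with hb
  set c : κ → l → ℝ := fun j k => m.real (g ⁻¹' {j} ∩ h ⁻¹' {k}) with hc
  set d : l → ℝ := fun k => m.real (h ⁻¹' {k}) with hd
  have hab : ∀ i k, ∑ j, a i j k = b i k := by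
    intro i k
    rw [hb]
    simp only
    rw [← sum_real (m := m) hg ((hf i).inter (hh k))]
    refine Finset.sum_congr rfl fun j _ => ?_
    rw [hadef]; simp only
    congr 1
    ext x; simp; tauto
  have hac : ∀ j k, ∑ i, a i j k = c j k := fun j k => sum_real (m := m) hf ((hg j).inter (hh k))
  have hbd : ∀ k, ∑ i, b i k = d k := fun k => sum_real (m := m) hf (hh k)
  have hcd : ∀ k, ∑ j, c j k = d k := fun k => sum_real (m := m) hg (hh k)
  have e1 : H m (pr f (pr g h)) = ∑ k, ∑ i, ∑ j, -(a i j k * Real.log (a i j k)) := by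
    rw [H_pr, Finset.sum_comm, Fintype.sum_prod_type, Finset.sum_comm]
    refine Finset.sum_congr rfl fun k _ => ?_
    rw [Finset.sum_comm]
    refine Finset.sum_congr rfl fun i _ => Finset.sum_congr rfl fun j _ => ?_
    rw [pr_pre]
    simp only [Real.negMulLog, hadef, neg_mul]
  have e2 : H m h = ∑ k, ∑ i, ∑ j, -(a i j k * Real.log (d k)) := by
    rw [H]
    refine Finset.sum_congr rfl fun k _ => ?_
    simp_rw [Finset.sum_neg_distrib, ← Finset.sum_mul, hab, hbd]
    simp only [Real.negMulLog, hd, neg_mul]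
  have e3 : H m (pr f h) = ∑ k, ∑ i, ∑ j, -(a i j k * Real.log (b i k)) := by
    rw [H_pr, Finset.sum_comm]
    refine Finset.sum_congr rfl fun k _ => Finset.sum_congr rfl fun i _ => ?_
    simp_rw [Finset.sum_neg_distrib, ← Finset.sum_mul, hab]
    simp only [Real.negMulLog, hb, neg_mul]
  have e4 : H m (pr g h) = ∑ k, ∑ i, ∑ j, -(a i j k * Real.log (c j k)) := by
    rw [H_pr, Finset.sum_comm]
    refine Finset.sum_congr rfl fun k _ => ?_
    rw [Finset.sum_comm]
    refine Finset.sum_congr rfl fun j _ => ?_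
    simp_rw [Finset.sum_neg_distrib, ← Finset.sum_mul, hac]
    simp only [Real.negMulLog, hc, neg_mul]
  have key : ∑ k, ∑ i, ∑ j, (a i j k * (Real.log (b i k) + Real.log (c j k) - Real.log (a i j k)
      - Real.log (d k))) ≤ ∑ k, ∑ i, ∑ j, (b i k * c j k / d k - a i j k) := by
    refine Finset.sum_le_sum fun k _ => Finset.sum_le_sum fun i _ => Finset.sum_le_sum fun j _ => ?_
    have ha : 0 ≤ a i j k := measureReal_nonneg
    have hb0 : 0 ≤ b i k := measureReal_nonneg
    have hc0 : 0 ≤ c j k := measureReal_nonneg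
    have hd0 : 0 ≤ d k := measureReal_nonneg
    rcases ha.eq_or_lt with h0 | h0
    · rw [← h0]; simp only [zero_mul, sub_zero]; positivity
    have hb1 : 0 < b i k := h0.trans_le (measureReal_mono fun x hx => ⟨hx.1, hx.2.2⟩)
    have hc1 : 0 < c j k := h0.trans_le (measureReal_mono fun x hx => hx.2)
    have hd1 : 0 < d k := h0.trans_le (measureReal_mono fun x hx => hx.2.2)
    have hl := Real.log_le_sub_one_of_pos (show 0 < b i k * c j k / (a i j k * d k) by positivity)
    rw [Real.log_div (by positivity) (by positivity), Real.log_mul hb1.ne' hc1.ne',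
      Real.log_mul h0.ne' hd1.ne'] at hl
    have := mul_le_mul_of_nonneg_left hl ha
    calc _ = a i j k * (Real.log (b i k) + Real.log (c j k) - (Real.log (a i j k)
        + Real.log (d k))) := by ring
      _ ≤ _ := this
      _ = _ := by field_simp
  have z : ∑ k, ∑ i, ∑ j, (b i k * c j k / d k - a i j k) = 0 := by
    refine Finset.sum_eq_zero fun k _ => ?_
    have : ∀ i, ∑ j, (b i k * c j k / d k - a i j k) = 0 := by
      intro i
      rw [Finset.sum_sub_distrib, hab, ← Finset.sum_div, ← Finset.mul_sum, hcd]
      by_cases h0 : d k = 0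
      · have : b i k = 0 := le_antisymm (h0 ▸ measureReal_mono inter_subset_right) measureReal_nonneg
        rw [this]; simp
      · field_simp; simp
    simp [this]
  rw [e1, e2, e3, e4]
  rw [z] at key
  have : ∑ k, ∑ i, ∑ j, (a i j k * (Real.log (b i k) + Real.log (c j k) - Real.log (a i j k)
      - Real.log (d k))) =  (∑ k, ∑ i, ∑ j, -(a i j k * Real.log (a i j k)) +
       ∑ k, ∑ i, ∑ j, -(a i j k * Real.log (d k))) -
      ( ∑ k, ∑ i, ∑ j, -(a i j k * Real.log (b i k)) +
       ∑ k, ∑ i, ∑ j, -(a i j k * Real.log (c j k))) := by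
    simp only [← Finset.sum_add_distrib, ← Finset.sum_sub_distrib]
    refine Finset.sum_congr rfl fun k _ => Finset.sum_congr rfl fun i _ =>
      Finset.sum_congr rfl fun j _ => ?_
    ring
  linarith

lemma cH_anti {m : Measure X} [IsFiniteMeasure m] {f : X → ι} {g : X → κ} {h : X → l}
    (hf : FM f) (hg : FM g) (hh : FM h) (hd : Det m g h) : cH m f g ≤ cH m f h := by
  have := ssa (m := m) hf hg hh
  have e1 := hd.H_eq
  have e2 : H m (pr f (pr g h)) = H m (pr f g) := by
    have : Det m (pr f g) h := by
      obtain ⟨E, hE, hd⟩ := hd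
      exact ⟨E, hE, fun x hx y hy hxy => hd x hx y hy (congrArg Prod.snd hxy)⟩
    rw [← H_assoc, this.H_eq]
  unfold cH
  linarith

lemma cH_congr_left {m : Measure X} {f : X → ι} {f' : X → κ} {g : X → l}
    (h : Det m f f') (h' : Det m f' f) : cH m f g = cH m f' g := by
  unfold cH
  congr 1
  rw [H_swap, H_swap m f']
  exact H_congr_det (h.pr_left g) (h'.pr_left g)

lemma cH_mono_left {m : Measure X} [IsFiniteMeasure m] {f : X → ι} {f' : X → κ} {g : X → l}
    (hf : FM f) (hf' : FM f') (hg : FM g) (h : Det m f' f) : cH m f g ≤ cH m f' g := by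
  unfold cH
  rw [H_swap, H_swap m f']
  linarith [H_le_of_det (m := m) (hg.pr hf) (hg.pr hf') (h.pr_left g)]

lemma cH_det {m : Measure X} {f : X → ι} {g : X → κ} (h : Det m g f) : cH m f g = 0 := by
  unfold cH
  rw [H_swap, h.H_eq, sub_self]

lemma cH_pr_le {m : Measure X} [IsFiniteMeasure m] {f : X → ι} {f' : X → κ} {g : X → l}
    (hf : FM f) (hf' : FM f') (hg : FM g) : cH m (pr f f') g ≤ cH m f g + cH m f' g := by
  unfold cH
  rw [H_assoc]
  linarith [ssa (m := m) hf hf' hg]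

lemma cH_chain {m : Measure X} {f : X → ι} {f' : X → κ} {g : X → l} :
    cH m (pr f f') g = cH m f (pr f' g) + cH m f' g := by
  unfold cH
  rw [H_assoc]
  ring

lemma H_unit {m : Measure X} [IsProbabilityMeasure m] : H m (fun _ : X => ()) = 0 := by
  simp [H]

lemma cH_le_H {m : Measure X} [IsProbabilityMeasure m] {f : X → ι} {g : X → κ}
    (hf : FM f) (hg : FM g) : cH m f g ≤ H m f := by
  have hu : FM (fun _ : X => ()) := fun i => by simp
  have := cH_anti (m := m) hf hg hu (det_of fun _ _ _ => rfl)
  refine this.trans ?_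
  unfold cH
  rw [H_unit, sub_zero]
  exact (Det.H_eq (det_of fun _ _ _ => rfl)).le

lemma cH_pi_le {m : Measure X} [IsFiniteMeasure m] {n : ℕ} {f : Fin n → X → ι} {g : X → κ}
    (hf : ∀ i, FM (f i)) (hg : FM g) :
    cH m (fun x i => f i x) g ≤ ∑ i, cH m (f i) g := by
  induction n with
  | zero => 
    rw [cH_det (det_of fun x y _ => Subsingleton.elim _ _)]; simp
  | succ n ih =>
    rw [Fin.sum_univ_succ]
    have h2 : FM (fun x (i : Fin n) => f i.succ x) :=
      FM.pi (f := fun i : Fin n => f i.succ) fun i => hf i.succ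
    have h3 : FM (fun x i => f i x) := FM.pi hf
    have h4 : cH m (fun x i => f i x) g ≤ cH m (pr (f 0) (fun x (i : Fin n) => f i.succ x)) g := by
      refine cH_mono_left h3 ((hf 0).pr h2) hg (det_of ?_)
      intro x y hxy
      simp only [pr, Prod.mk.injEq] at hxy
      funext i
      exact Fin.cases hxy.1 (fun j => congrFun hxy.2 j) i
    have h5 := cH_pr_le (m := m) (hf 0) h2 hg
    have h6 := ih (f := fun i => f i.succ) (fun i => hf i.succ)
    linarith

/-- restriction splitting -/
lemma H_split {m : Measure X} [IsFiniteMeasure m] {f : X → ι} (hf : FM f) {E : Set X}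
    (hE : MeasurableSet E) (h : ∀ x y, f x = f y → (x ∈ E ↔ y ∈ E)) :
    H m f = H (m.restrict E) f + H (m.restrict Eᶜ) f := by
  unfold H
  rw [← Finset.sum_add_distrib]
  refine Finset.sum_congr rfl fun i _ => ?_
  rw [measureReal_restrict_apply (hf i), measureReal_restrict_apply (hf i)]
  by_cases hex : ∃ y ∈ E, f y = i
  · obtain ⟨y, hyE, hy⟩ := hex
    have h1 : f ⁻¹' {i} ∩ E = f ⁻¹' {i} := by
      ext x; simp only [mem_inter_iff, mem_preimage, mem_singleton_iff, and_iff_left_iff_imp]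
      intro hx; exact (h x y (hx.trans hy.symm)).2 hyE
    have h2 : f ⁻¹' {i} ∩ Eᶜ = ∅ := by
      rw [← h1]; ext x; simp
    rw [h1, h2]; simp
  · push Not at hex
    have h1 : f ⁻¹' {i} ∩ Eᶜ = f ⁻¹' {i} := by
      ext x; simp only [mem_inter_iff, mem_preimage, mem_singleton_iff, and_iff_left_iff_imp]
      intro hx hxE; exact hex x hxE hx
    have h2 : f ⁻¹' {i} ∩ E = ∅ := by
      rw [← h1]; ext x; simp
    rw [h1, h2]; simp

lemma cH_split {m : Measure X} [IsFiniteMeasure m] {f : X → ι} {g : X → κ} (hf : FM f)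
    (hg : FM g) {E : Set X}
    (hE : MeasurableSet E) (h : ∀ x y, g x = g y → (x ∈ E ↔ y ∈ E)) :
    cH m f g = cH (m.restrict E) f g + cH (m.restrict Eᶜ) f g := by
  unfold cH
  rw [H_split hg hE h, H_split (hf.pr hg) hE fun x y hxy => h x y (congrArg Prod.snd hxy)]
  ring

lemma H_map {Y : Type*} [MeasurableSpace Y] {m : Measure X} {D : X → Y} (hD : Measurable D)
    {f : Y → ι} (hf : FM f) : H (m.map D) f = H m (fun x => f (D x)) := by
  unfold H
  refine Finset.sum_congr rfl fun i _ => ?_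
  rw [map_measureReal_apply hD (hf i)]
  rfl

lemma cH_map {Y : Type*} [MeasurableSpace Y] {m : Measure X} {D : X → Y} (hD : Measurable D)
    {f : Y → ι} {g : Y → κ} (hf : FM f) (hg : FM g) :
    cH (m.map D) f g = cH m (fun x => f (D x)) (fun x => g (D x)) := by
  unfold cH
  rw [H_map hD hg, H_map hD (hf.pr hg)]
  rfl

lemma H_smul {m : Measure X} [IsFiniteMeasure m] {f : X → ι} (hf : FM f) (c : ℝ≥0∞) :
    H (c • m) f = c.toReal * H m f + Real.negMulLog c.toReal * m.real univ := by
  unfold H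
  rw [← sum_real_univ (m := m) hf, Finset.mul_sum, Finset.mul_sum, ← Finset.sum_add_distrib]
  refine Finset.sum_congr rfl fun i _ => ?_
  rw [measureReal_ennreal_smul_apply, Real.negMulLog_mul]
  ring

lemma cH_smul {m : Measure X} [IsFiniteMeasure m] {f : X → ι} {g : X → κ} (hf : FM f) (hg : FM g)
    (c : ℝ≥0∞) : cH (c • m) f g = c.toReal * cH m f g := by
  unfold cH
  rw [H_smul hg, H_smul (hf.pr hg)]
  ring

/-- Fano-type estimate -/
lemma fano (ι : Type) [Fintype ι] {δ : ℝ} (hδ : 0 < δ) : ∃ η > 0, ∀ {X : Type*} [MeasurableSpace X]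
    (m : Measure X) [IsProbabilityMeasure m] (f g : X → ι), FM f → FM g →
    m.real {x | f x ≠ g x} < η → cH m f g ≤ δ := by
  classical
  have huc : UniformContinuousOn Real.negMulLog (Icc 0 1) :=
    isCompact_Icc.uniformContinuousOn_of_continuous Real.continuous_negMulLog.continuousOn
  rw [Metric.uniformContinuousOn_iff] at huc
  set N : ℝ := (Fintype.card ι : ℝ) * Fintype.card ι + 1
  have hN : 0 < N := by positivity
  obtain ⟨η, hη, hu⟩ := huc (δ / N) (by positivity)
  refine ⟨η, hη, fun {X} _ m _ f g hf hg hfg => ?_⟩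
  have h01 : ∀ s : Set X, m.real s ∈ Icc (0 : ℝ) 1 := fun s => ⟨measureReal_nonneg, measureReal_le_one⟩
  unfold cH
  rw [H_swap, H_pr, H, ← Finset.sum_sub_distrib]
  have hj : ∀ j, ∑ i, Real.negMulLog (m.real (g ⁻¹' {j} ∩ f ⁻¹' {i})) -
      Real.negMulLog (m.real (g ⁻¹' {j})) ≤ (Fintype.card ι) * (δ / N) := by
    intro j
    rw [← Finset.sum_erase_add _ _ (Finset.mem_univ j)]
    have h1 : ∀ i ∈ Finset.univ.erase j,
        Real.negMulLog (m.real (g ⁻¹' {j} ∩ f ⁻¹' {i})) ≤ δ / N := by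
      intro i hi
      have := hu _ (h01 (g ⁻¹' {j} ∩ f ⁻¹' {i})) 0 (by simp) ?_
      · rw [Real.dist_eq, Real.negMulLog_zero, sub_zero] at this
        exact (le_abs_self _).trans this.le
      · rw [Real.dist_eq, sub_zero, abs_of_nonneg measureReal_nonneg]
        refine lt_of_le_of_lt (measureReal_mono ?_) hfg
        rintro x ⟨h1, h2⟩ h3
        apply Finset.ne_of_mem_erase hi
        rw [← h2, ← h1]
        exact h3
    have h2 : Real.negMulLog (m.real (g ⁻¹' {j} ∩ f ⁻¹' {j})) -
        Real.negMulLog (m.real (g ⁻¹' {j})) ≤ δ / N := by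
      have := hu _ (h01 (g ⁻¹' {j} ∩ f ⁻¹' {j})) _ (h01 (g ⁻¹' {j})) ?_
      · rw [Real.dist_eq] at this
        exact (le_abs_self _).trans this.le
      · rw [dist_comm, Real.dist_eq]
        have e : m.real (g ⁻¹' {j}) = m.real (g ⁻¹' {j} ∩ f ⁻¹' {j}) +
            m.real (g ⁻¹' {j} \ f ⁻¹' {j}) := (measureReal_inter_add_sdiff (hf j)).symm
        rw [e, add_sub_cancel_left, abs_of_nonneg measureReal_nonneg]
        refine lt_of_le_of_lt (measureReal_mono ?_) hfg
        rintro x ⟨h1, h2⟩ h3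
        exact h2 (h3.trans h1)
    have h3 := Finset.sum_le_card_nsmul _ _ _ h1
    rw [Finset.card_erase_of_mem (Finset.mem_univ _), Finset.card_univ, nsmul_eq_mul] at h3
    have hpos : 0 < Fintype.card ι := Fintype.card_pos_iff.2 ⟨j⟩
    rw [Nat.cast_sub hpos] at h3
    push_cast at h3
    linarith
  refine (Finset.sum_le_card_nsmul _ _ _ fun j _ => hj j).trans ?_
  rw [Finset.card_univ, nsmul_eq_mul, ← mul_assoc, ← mul_div_assoc, div_le_iff₀ hN, mul_comm δ]
  gcongr
  simp [N]

end Abr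

set_option linter.unusedSectionVars false
set_option linter.unusedVariables false

namespace Abr
open Filter Topology

variable {X : Type*} [MeasurableSpace X] {ι κ : Type} [Fintype ι] [Fintype κ]

/-- The `n`-block name. -/
def blk {X : Type*} {ι : Type} (T : X → X) (f : X → ι) (n : ℕ) : X → (Fin n → ι) :=
  fun x i => f (T^[(i : ℕ)] x)

/-- Dynamical entropy along a finite label function. -/
noncomputable def hE (μ : Measure X) (T : X → X) (f : X → ι) : ℝ :=
  ⨅ n : ℕ, H μ (blk T f (n + 1)) / ((n : ℝ) + 1)

/-- The conditional entropy increments. -/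
noncomputable def dE (μ : Measure X) (T : X → X) (f : X → ι) (n : ℕ) : ℝ :=
  cH μ f (fun x => blk T f n (T x))

lemma FM.iter {f : X → ι} (hf : FM f) {T : X → X} (hT : Measurable T) (n : ℕ) :
    FM (fun x => f (T^[n] x)) := hf.of_comp (hT.iterate n)

lemma FM.blk {f : X → ι} (hf : FM f) {T : X → X} (hT : Measurable T) (n : ℕ) :
    FM (blk T f n) := FM.pi (f := fun (i : Fin n) x => f (T^[(i : ℕ)] x)) fun i => hf.iter hT i

lemma blk_eq_iff {X : Type*} {ι : Type} (T : X → X) (f : X → ι) (n : ℕ) (x y : X) :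
    blk T f n x = blk T f n y ↔ ∀ i < n, f (T^[i] x) = f (T^[i] y) := by
  constructor
  · intro h i hi; exact congrFun h ⟨i, hi⟩
  · intro h; funext i; exact h i i.2

lemma H_mp {μ : Measure X} {T : X → X} (hT : MeasurePreserving T μ μ) {f : X → ι} (hf : FM f) :
    H μ (fun x => f (T x)) = H μ f := by
  rw [← H_map hT.measurable hf, hT.map_eq]

lemma cH_mp {μ : Measure X} {T : X → X} (hT : MeasurePreserving T μ μ) {f : X → ι} (hf : FM f)
    {g : X → κ} (hg : FM g) :
    cH μ (fun x => f (T x)) (fun x => g (T x)) = cH μ f g := by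
  rw [← cH_map hT.measurable hf hg, hT.map_eq]

lemma H_blk_succ {μ : Measure X} {T : X → X} (hT : MeasurePreserving T μ μ) {f : X → ι}
    (hf : FM f) (n : ℕ) : H μ (blk T f (n + 1)) = dE μ T f n + H μ (blk T f n) := by
  unfold dE cH
  rw [H_mp hT (hf.blk hT.measurable n), sub_add_cancel]
  apply H_congr_det
  · apply det_of
    intro x y h
    rw [blk_eq_iff] at h
    simp only [pr, Prod.mk.injEq, blk_eq_iff]
    refine ⟨h 0 (by omega), fun i hi => ?_⟩
    exact h (i + 1) (by omega)
  · apply det_of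
    intro x y h
    simp only [pr, Prod.mk.injEq, blk_eq_iff] at h
    rw [blk_eq_iff]
    intro i hi
    rcases i with _ | i
    · exact h.1
    · exact h.2 i (by omega)

lemma H_blk_zero {μ : Measure X} [IsProbabilityMeasure μ] {T : X → X} {f : X → ι} :
    H μ (blk T f 0) = 0 := by
  have := H_congr_det (m := μ) (f := blk T f 0) (g := fun _ => ()) (det_of fun _ _ _ => rfl)
    (det_of fun _ _ _ => Subsingleton.elim _ _)
  rw [this, H_unit]

lemma dE_anti {μ : Measure X} [IsFiniteMeasure μ] {T : X → X} (hT : Measurable T) {f : X → ι}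
    (hf : FM f) : Antitone (dE μ T f) := by
  intro a b hab
  refine cH_anti hf ((hf.blk hT b).of_comp hT) ((hf.blk hT a).of_comp hT) (det_of ?_)
  intro x y h
  rw [blk_eq_iff] at h ⊢
  exact fun i hi => h i (by omega)

lemma dE_nonneg {μ : Measure X} [IsFiniteMeasure μ] {T : X → X} (hT : Measurable T) {f : X → ι}
    (hf : FM f) (n : ℕ) : 0 ≤ dE μ T f n :=
  cH_nonneg hf ((hf.blk hT n).of_comp hT)

section
variable {μ : Measure X} [IsProbabilityMeasure μ] {T : X → X}

lemma H_blk_sum (hT : MeasurePreserving T μ μ) {f : X → ι} (hf : FM f) (n : ℕ) :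
    H μ (blk T f n) = ∑ i ∈ Finset.range n, dE μ T f i := by
  induction n with
  | zero => simp [H_blk_zero]
  | succ n ih => rw [H_blk_succ hT hf, ih, Finset.sum_range_succ]; ring

lemma hE_aux (hT : MeasurePreserving T μ μ) {f : X → ι} (hf : FM f) :
    Tendsto (dE μ T f) atTop (𝓝 (hE μ T f)) ∧
    Tendsto (fun n : ℕ => H μ (blk T f n) / n) atTop (𝓝 (hE μ T f)) := by
  have hanti := dE_anti (μ := μ) hT.measurable hf
  have hbdd : BddBelow (range (dE μ T f)) :=
    ⟨0, by rintro _ ⟨n, rfl⟩; exact dE_nonneg hT.measurable hf n⟩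
  have hlim := tendsto_atTop_ciInf hanti hbdd
  set L := ⨅ n, dE μ T f n
  have hL : ∀ n, L ≤ dE μ T f n := fun n => ciInf_le hbdd n
  have hces := hlim.cesaro
  have hces' : Tendsto (fun n : ℕ => H μ (blk T f n) / n) atTop (𝓝 L) := by
    refine hces.congr fun n => ?_
    rw [H_blk_sum hT hf]; field_simp
  have hEL : hE μ T f = L := by
    have hge : ∀ n : ℕ, L ≤ H μ (blk T f (n + 1)) / ((n : ℝ) + 1) := by
      intro n
      rw [le_div_iff₀ (by positivity), H_blk_sum hT hf]
      have := Finset.card_nsmul_le_sum (Finset.range (n + 1)) (dE μ T f) L (fun i _ => hL i)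
      rw [Finset.card_range, nsmul_eq_mul] at this
      push_cast at this
      linarith
    apply le_antisymm
    · have h2 := hces'.comp (tendsto_add_atTop_nat 1)
      refine ge_of_tendsto' h2 fun n => ?_
      have := ciInf_le (f := fun n : ℕ => H μ (blk T f (n + 1)) / ((n : ℝ) + 1))
        ⟨L, by rintro _ ⟨n, rfl⟩; exact hge n⟩ n
      simpa [hE] using this
    · exact le_ciInf hge
  rw [hEL]
  exact ⟨hlim, hces'⟩

lemma tendsto_dE (hT : MeasurePreserving T μ μ) {f : X → ι} (hf : FM f) :
    Tendsto (dE μ T f) atTop (𝓝 (hE μ T f)) := (hE_aux hT hf).1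

lemma tendsto_hE (hT : MeasurePreserving T μ μ) {f : X → ι} (hf : FM f) :
    Tendsto (fun n : ℕ => H μ (blk T f n) / n) atTop (𝓝 (hE μ T f)) := (hE_aux hT hf).2

lemma hE_nonneg (hT : MeasurePreserving T μ μ) {f : X → ι} (hf : FM f) : 0 ≤ hE μ T f :=
  ge_of_tendsto' (tendsto_dE hT hf) fun n => dE_nonneg hT.measurable hf n

lemma hE_le_add (hT : MeasurePreserving T μ μ) {f : X → ι} (hf : FM f) {g : X → κ} (hg : FM g) :
    hE μ T f ≤ hE μ T g + cH μ f g := by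
  have h1 := tendsto_hE hT hf
  have h2 := (tendsto_hE hT hg).add_const (cH μ f g)
  refine le_of_tendsto_of_tendsto h1 h2 ?_
  filter_upwards [eventually_gt_atTop 0] with n hn
  have hn' : (0 : ℝ) < n := by exact_mod_cast hn
  rw [div_add' _ _ _ hn'.ne']
  refine div_le_div_of_nonneg_right ?_ hn'.le
  have hF := hf.blk hT.measurable n
  have hG := hg.blk hT.measurable n
  have a1 := H_le_pr (m := μ) hF hG
  have a2 : cH μ (blk T f n) (blk T g n) ≤ ∑ i : Fin n, cH μ (fun x => f (T^[(i : ℕ)] x)) (blk T g n) :=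
    cH_pi_le (f := fun (i : Fin n) x => f (T^[(i : ℕ)] x)) (fun i => hf.iter hT.measurable i) hG
  have a3 : ∀ i : Fin n, cH μ (fun x => f (T^[(i : ℕ)] x)) (blk T g n) ≤ cH μ f g := by
    intro i
    rw [← cH_mp (hT.iterate i) hf hg]
    exact cH_anti (hf.iter hT.measurable i) hG (hg.iter hT.measurable i)
      (det_of fun x y h => congrFun h i)
  have a4 := Finset.sum_le_card_nsmul Finset.univ _ _ (fun i _ => a3 i)
  rw [Finset.card_univ, Fintype.card_fin, nsmul_eq_mul] at a4
  unfold cH at a2 a4 ⊢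
  linarith

lemma hE_mono (hT : MeasurePreserving T μ μ) {f : X → ι} (hf : FM f) {g : X → κ} (hg : FM g)
    (h : Det μ g f) : hE μ T f ≤ hE μ T g := by
  have := hE_le_add hT hf hg
  rwa [cH_det h, add_zero] at this

lemma hE_pow (hT : MeasurePreserving T μ μ) {f : X → ι} (hf : FM f) {m : ℕ} (hm : 0 < m) :
    hE μ (T^[m]) (blk T f m) = m * hE μ T f := by
  have h1 := tendsto_hE (hT.iterate m) (hf.blk hT.measurable m)
  have hmul : Tendsto (fun n : ℕ => m * n) atTop atTop := tendsto_id.const_mul_atTop' hm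
  have h2 := ((tendsto_hE hT hf).comp hmul).const_mul (m : ℝ)
  refine tendsto_nhds_unique h1 (h2.congr fun n => ?_)
  have e : H μ (blk T^[m] (blk T f m) n) = H μ (blk T f (m * n)) := by
    apply H_congr_det
    · apply det_of
      intro x y h
      rw [blk_eq_iff] at h ⊢
      intro i hi
      have := h (i / m) (Nat.div_lt_of_lt_mul hi)
      rw [blk_eq_iff] at this
      have := this (i % m) (Nat.mod_lt _ hm)
      rwa [← Function.iterate_mul, ← Function.iterate_add_apply, ← Function.iterate_add_apply,
        Nat.mod_add_div] at this
    · apply det_of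
      intro x y h
      rw [blk_eq_iff] at h ⊢
      intro i hi
      rw [blk_eq_iff]
      intro j hj
      rw [← Function.iterate_mul, ← Function.iterate_add_apply, ← Function.iterate_add_apply]
      apply h
      calc j + m * i < m + m * i := by omega
        _ = m * (i + 1) := by ring
        _ ≤ m * n := Nat.mul_le_mul_left _ hi
  rw [e]
  simp only [Function.comp]
  have : (m : ℝ) ≠ 0 := by exact_mod_cast hm.ne'
  push_cast
  rw [← div_div, mul_div_assoc', mul_div_cancel₀ _ this]

end

/-- factor maps -/
lemma hE_factor {Y : Type*} [MeasurableSpace Y] {μ : Measure X} {ν : Measure Y} {T : X → X}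
    {S : Y → Y} {π : X → Y} (hπ : MeasurePreserving π μ ν) (hS : Measurable S)
    (hc : ∀ x, π (T x) = S (π x)) {f : Y → ι} (hf : FM f) :
    hE μ T (fun x => f (π x)) = hE ν S f := by
  have hit : ∀ (n : ℕ) x, π (T^[n] x) = S^[n] (π x) := by
    intro n
    induction n with
    | zero => intro x; rfl
    | succ n ih => intro x; rw [Function.iterate_succ_apply, Function.iterate_succ_apply, ih, hc]
  unfold hE
  congr 1
  funext n
  congr 1
  rw [← hπ.map_eq, H_map hπ.measurable (hf.blk hS _)]
  congr 1
  funext x i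
  simp [blk, hit]

lemma le_kol {μ : Measure X} {T : X → X} {f : X → ι} (hf : FM f) :
    ENNReal.ofReal (hE μ T f) ≤ kolSinaiEntropy μ T := by
  classical
  let e := Fintype.equivFin ι
  let P : Fin (Fintype.card ι) → Set X := fun i => f ⁻¹' {e.symm i}
  have hP : IsFinMeasPartition P := by
    refine ⟨fun i => hf _, fun i j hij => ?_, ?_⟩
    · rw [Set.disjoint_left]
      intro x h1 h2
      exact hij (e.symm.injective (h1.symm.trans h2))
    · ext x
      simp only [P, mem_iUnion, mem_preimage, mem_singleton_iff, mem_univ, iff_true]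
      exact ⟨e (f x), by simp⟩
  have h1 : ENNReal.ofReal (entropyAlongPartition μ T P) ≤ kolSinaiEntropy μ T := by
    unfold kolSinaiEntropy
    exact le_iSup_of_le _ (le_iSup_of_le P (le_iSup_of_le hP le_rfl))
  refine le_trans (le_of_eq ?_) h1
  congr 1
  unfold hE entropyAlongPartition
  congr 1
  funext n
  congr 1
  unfold H dynRefinedEntropy
  refine Fintype.sum_equiv (Equiv.arrowCongr (Equiv.refl _) e) _ _ fun p => ?_
  rw [measureReal_def]
  congr 3
  ext x
  simp [blk, funext_iff, P]

lemma kol_le {μ : Measure X} {T : X → X} {c : ℝ≥0∞}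
    (h : ∀ (k : ℕ) (f : X → Fin k), FM f → ENNReal.ofReal (hE μ T f) ≤ c) :
    kolSinaiEntropy μ T ≤ c := by
  unfold kolSinaiEntropy
  refine iSup_le fun k => iSup_le fun P => iSup_le fun hP => ?_
  obtain ⟨hm, hd, hu⟩ := hP
  have hex : ∀ x, ∃ i, x ∈ P i := fun x => by
    have : x ∈ ⋃ i, P i := hu ▸ mem_univ x
    simpa using this
  choose f hf using hex
  have hpre : ∀ i, f ⁻¹' {i} = P i := by
    intro i
    ext x
    constructor
    · intro h; rw [← show f x = i from h]; exact hf x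
    · intro h
      by_contra hne
      exact Set.disjoint_left.1 (hd _ _ hne) (hf x) h
  have hFM : FM f := fun i => by rw [hpre]; exact hm i
  refine le_trans (le_of_eq ?_) (h k f hFM)
  congr 1
  unfold hE entropyAlongPartition
  congr 1
  funext n
  congr 1
  unfold H dynRefinedEntropy
  refine Finset.sum_congr rfl fun p _ => ?_
  rw [measureReal_def]
  congr 3
  ext x
  simp only [mem_iInter, mem_preimage, mem_singleton_iff, blk, funext_iff]
  refine forall_congr' fun i => ?_
  rw [← hpre]; rfl

lemma kol_factor_le {Y : Type*} [MeasurableSpace Y] {μ : Measure X} {ν : Measure Y} {T : X → X}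
    {S : Y → Y} {π : X → Y} (hπ : MeasurePreserving π μ ν) (hS : Measurable S)
    (hc : ∀ x, π (T x) = S (π x)) : kolSinaiEntropy ν S ≤ kolSinaiEntropy μ T := by
  refine kol_le fun k f hf => ?_
  rw [← hE_factor hπ hS hc hf]
  exact le_kol (hf.of_comp hπ.measurable)

lemma kol_pow {μ : Measure X} [IsProbabilityMeasure μ] {T : X → X} (hT : MeasurePreserving T μ μ)
    {m : ℕ} (hm : 0 < m) : kolSinaiEntropy μ (T^[m]) = m * kolSinaiEntropy μ T := by
  have hm0 : (m : ℝ≥0∞) ≠ 0 := by exact_mod_cast hm.ne'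
  apply le_antisymm
  · refine kol_le fun k f hf => ?_
    have h1 : hE μ (T^[m]) f ≤ m * hE μ T f := by
      rw [← hE_pow hT hf hm]
      refine hE_mono (hT.iterate m) hf (hf.blk hT.measurable m) (det_of ?_)
      intro x y h
      rw [blk_eq_iff] at h
      exact h 0 hm
    refine (ENNReal.ofReal_le_ofReal h1).trans ?_
    rw [ENNReal.ofReal_mul (by positivity), ENNReal.ofReal_natCast]
    gcongr
    exact le_kol hf
  · rw [mul_comm, ← ENNReal.le_div_iff_mul_le (Or.inl hm0) (Or.inl (by simp))]
    refine kol_le fun k f hf => ?_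
    rw [ENNReal.le_div_iff_mul_le (Or.inl hm0) (Or.inl (by simp)), mul_comm,
      ← ENNReal.ofReal_natCast, ← ENNReal.ofReal_mul (by positivity), ← hE_pow hT hf hm]
    exact le_kol (hf.blk hT.measurable m)

end Abr

set_option linter.unusedSectionVars false
set_option linter.unusedVariables false

namespace Abr
open Filter Topology

section tower
variable {Y Z : Type*} [MeasurableSpace Y] [MeasurableSpace Z]

/-- Tower structure: `Y` with map `S` is a Kakutani tower over `Z` with map `G`. -/
structure Tower (μ : Measure Y) (S : Y → Y) (m : Measure Z) (G : Z → Z) (κ0 : ℝ≥0∞)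
    (D : Y → Z) (j : Y → ℕ) (n : Z → ℕ) (M : ℕ) : Prop where
  hS : MeasurePreserving S μ μ
  hG : MeasurePreserving G m m
  hD : Measurable D
  hj : Measurable j
  hn : Measurable n
  hjM : ∀ y, j y < M
  hnM : ∀ z, n z < M
  hmap : (μ.restrict {y | j (S y) = 0}).map D = κ0 • m
  hup : ∀ y, j (S y) ≠ 0 → D (S y) = D y ∧ j (S y) = j y + 1
  hret : ∀ y, j (S y) = 0 → D (S y) = G (D y)
  hiff : ∀ y, j (S y) = 0 ↔ j y = n (D y)

variable {μ : Measure Y} {S : Y → Y} {m : Measure Z} {G : Z → Z} {κ0 : ℝ≥0∞}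
    {D : Y → Z} {j : Y → ℕ} {n : Z → ℕ} {M : ℕ}

/-- Lifted label on the tower. -/
def lift (h : Tower μ S m G κ0 D j n M) {ι : Type} (α : Z → ι) : Y → ι × Fin M :=
  fun y => (α (D y), ⟨j y, h.hjM y⟩)

lemma Tower.lift_eq (h : Tower μ S m G κ0 D j n M) {ι : Type} (α : Z → ι) (y y' : Y) :
    lift h α y = lift h α y' ↔ α (D y) = α (D y') ∧ j y = j y' := by
  simp [lift]

lemma Tower.lift_FM (h : Tower μ S m G κ0 D j n M) {ι : Type} [Fintype ι] {α : Z → ι} (hα : FM α) :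
    FM (lift h α) := by
  apply FM.pr (hα.of_comp h.hD)
  intro i
  have : (fun y => (⟨j y, h.hjM y⟩ : Fin M)) ⁻¹' {i} = j ⁻¹' {(i : ℕ)} := by
    ext y; simp [Fin.ext_iff]
  rw [this]
  exact h.hj (measurableSet_singleton _)

lemma Tower.climb (h : Tower μ S m G κ0 D j n M) (w : Y) (hw : j w = 0) :
    ∀ i ≤ n (D w), D (S^[i] w) = D w ∧ j (S^[i] w) = i := by
  intro i
  induction i with
  | zero => intro _; exact ⟨rfl, hw⟩
  | succ i ih =>
    intro hi
    obtain ⟨h1, h2⟩ := ih (by omega)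
    rw [Function.iterate_succ_apply']
    have hne : j (S (S^[i] w)) ≠ 0 := by
      rw [Ne, h.hiff, h1, h2]; omega
    obtain ⟨h3, h4⟩ := h.hup _ hne
    rw [h3, h4, h1, h2]
    exact ⟨rfl, rfl⟩

lemma Tower.ret (h : Tower μ S m G κ0 D j n M) (w : Y) (hw : j w = 0) :
    D (S^[n (D w) + 1] w) = G (D w) ∧ j (S^[n (D w) + 1] w) = 0 := by
  obtain ⟨h1, h2⟩ := h.climb w hw _ le_rfl
  rw [Function.iterate_succ_apply']
  have h0 : j (S (S^[n (D w)] w)) = 0 := by rw [h.hiff, h1, h2]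
  refine ⟨?_, h0⟩
  rw [h.hret _ h0, h1]

variable {ι : Type}

lemma Tower.claimA (h : Tower μ S m G κ0 D j n M) {α : Z → ι} {N : ι → ℕ}
    (hN : ∀ z, n z = N (α z)) {u v : Y} (hu : j u = 0) (hv : j v = 0) {k : ℕ}
    (huv : ∀ i < k, α (G^[i] (D u)) = α (G^[i] (D v))) :
    ∀ i < k, ∃ q ≤ i, D (S^[i] u) = G^[q] (D u) ∧ D (S^[i] v) = G^[q] (D v) ∧
      j (S^[i] u) = j (S^[i] v) := by
  intro i
  induction i with
  | zero => intro _; exact ⟨0, le_rfl, rfl, rfl, hu.trans hv.symm⟩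
  | succ i ih =>
    intro hi
    obtain ⟨q, hq, h1, h2, h3⟩ := ih (by omega)
    have hα : n (D (S^[i] u)) = n (D (S^[i] v)) := by
      rw [hN, hN, h1, h2, huv q (by omega)]
    rw [Function.iterate_succ_apply', Function.iterate_succ_apply']
    have hiff : j (S (S^[i] u)) = 0 ↔ j (S (S^[i] v)) = 0 := by
      rw [h.hiff, h.hiff, h3, hα]
    by_cases h0 : j (S (S^[i] u)) = 0
    · refine ⟨q + 1, by omega, ?_, ?_, h0.trans (hiff.1 h0).symm⟩
      · rw [h.hret _ h0, h1, Function.iterate_succ_apply']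
      · rw [h.hret _ (hiff.1 h0), h2, Function.iterate_succ_apply']
    · obtain ⟨a1, a2⟩ := h.hup _ h0
      obtain ⟨b1, b2⟩ := h.hup _ (fun hh => h0 (hiff.2 hh))
      exact ⟨q, by omega, a1.trans h1, b1.trans h2, by rw [a2, b2, h3]⟩

lemma Tower.claimB (h : Tower μ S m G κ0 D j n M) {α : Z → ι} {N : ι → ℕ}
    (hN : ∀ z, n z = N (α z)) {u v : Y} (hu : j u = 0) (hv : j v = 0) {k : ℕ}
    (huv : ∀ i < k, α (D (S^[i] u)) = α (D (S^[i] v))) :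
    ∀ q, q * M < k + M → q = 0 ∨ (q - 1) * M < k → ∃ i ≤ q * M, D (S^[i] u) = G^[q] (D u) ∧
      D (S^[i] v) = G^[q] (D v) ∧ j (S^[i] u) = 0 ∧ j (S^[i] v) = 0 := by
  intro q
  induction q with
  | zero => intro _ _; exact ⟨0, by simp, rfl, rfl, hu, hv⟩
  | succ q ih =>
    intro hq1 hq2
    have hq : q * M < k := by simpa using hq2
    obtain ⟨i, hi, h1, h2, h3, h4⟩ := ih (by omega) (by
      rcases q with _ | q
      · simp
      · right
        simp only [Nat.add_sub_cancel]
        refine lt_of_le_of_lt (Nat.mul_le_mul_right _ (Nat.le_succ q)) hq)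
    have hα : n (D (S^[i] u)) = n (D (S^[i] v)) := by
      rw [hN, hN, huv i (by omega)]
    obtain ⟨a1, a2⟩ := h.ret _ h3
    obtain ⟨b1, b2⟩ := h.ret _ h4
    rw [← hα] at b1 b2
    rw [← Function.iterate_add_apply] at a1 a2 b1 b2
    refine ⟨n (D (S^[i] u)) + 1 + i, ?_, ?_, ?_, a2, b2⟩
    · have := h.hnM (D (S^[i] u))
      rw [Nat.succ_mul]; omega
    · rw [a1, h1, Function.iterate_succ_apply']
    · rw [b1, h2, Function.iterate_succ_apply']

variable [Fintype ι] [IsProbabilityMeasure μ] [IsProbabilityMeasure m]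

lemma Tower.dE_bounds (h : Tower μ S m G κ0 D j n M) {α : Z → ι} (hα : FM α) {N : ι → ℕ}
    (hN : ∀ z, n z = N (α z)) {k q : ℕ} (hk : 0 < k) (hq : q * M ≤ k) :
    κ0.toReal * dE m G α k ≤ dE μ S (lift h α) k ∧
      dE μ S (lift h α) k ≤ κ0.toReal * dE m G α q := by
  set E : Set Y := {y | j (S y) = 0} with hEdef
  have hE : MeasurableSet E := (h.hj.comp h.hS.measurable) (measurableSet_singleton 0)
  have hL := h.lift_FM hα
  have hF : FM (fun y => blk S (lift h α) k (S y)) :=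
    (hL.blk h.hS.measurable k).of_comp h.hS.measurable
  have hαD : FM (fun y => α (D y)) := hα.of_comp h.hD
  have hblkG : ∀ k, FM (fun z => blk G α k (G z)) := fun k =>
    (hα.blk h.hG.measurable k).of_comp h.hG.measurable
  have e0 : dE μ S (lift h α) k = cH (μ.restrict E) (fun y => α (D y))
      (fun y => blk S (lift h α) k (S y)) := by
    unfold dE
    rw [cH_split hL hF hE]
    · have z : cH (μ.restrict Eᶜ) (lift h α) (fun y => blk S (lift h α) k (S y)) = 0 := by
        apply cH_det
        apply det_restrict hE.compl
        intro x hx y hy hxy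
        rw [blk_eq_iff] at hxy
        have := hxy 0 hk
        rw [h.lift_eq] at this ⊢
        simp only [Function.iterate_zero, id] at this
        obtain ⟨a1, a2⟩ := h.hup x hx
        obtain ⟨b1, b2⟩ := h.hup y hy
        rw [a1, b1, a2, b2] at this
        exact ⟨this.1, by omega⟩
      rw [z, add_zero]
      apply cH_congr_left
      · apply det_of
        intro x y hxy
        rw [h.lift_eq] at hxy
        exact hxy.1
      · apply det_restrict hE
        intro x hx y hy hxy
        rw [h.lift_eq]
        refine ⟨hxy, ?_⟩
        rw [(h.hiff x).1 hx, (h.hiff y).1 hy, hN, hN]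
        congr 1
    · intro x y hxy
      rw [blk_eq_iff] at hxy
      have := hxy 0 hk
      rw [h.lift_eq] at this
      simp only [Function.iterate_zero, id] at this
      simp [hEdef, this.2]
  have e1 : ∀ k, κ0.toReal * dE m G α k = cH (μ.restrict E) (fun y => α (D y))
      (fun y => blk G α k (G (D y))) := by
    intro k
    unfold dE
    rw [← cH_smul hα (hblkG k), ← h.hmap, cH_map h.hD hα (hblkG k)]
  rw [e0, e1, e1]
  constructor
  · refine cH_anti hαD ((hblkG k).of_comp h.hD) hF (det_restrict hE ?_)
    intro x hx y hy hxy
    rw [blk_eq_iff] at hxy ⊢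
    rw [← h.hret x hx, ← h.hret y hy] at hxy
    intro i hi
    obtain ⟨q, hq, h1, h2, h3⟩ := h.claimA hN hx hy hxy i hi
    rw [h.lift_eq]
    refine ⟨?_, h3⟩
    rw [h1, h2, hxy q (by omega)]
  · refine cH_anti hαD hF ((hblkG q).of_comp h.hD) (det_restrict hE ?_)
    intro x hx y hy hxy
    rw [blk_eq_iff] at hxy ⊢
    simp only [h.lift_eq] at hxy
    rw [← h.hret x hx, ← h.hret y hy]
    intro a ha
    have hM : 0 < M := lt_of_le_of_lt (Nat.zero_le _) (h.hjM x)
    have haM : a * M < k := by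
      refine lt_of_lt_of_le ?_ hq
      exact Nat.mul_lt_mul_of_pos_right ha hM
    obtain ⟨i, hi, h1, h2, -, -⟩ := h.claimB hN hx hy (fun i hi => (hxy i hi).1) a (by omega) (by
      right
      exact lt_of_le_of_lt (Nat.mul_le_mul_right _ (Nat.sub_le _ _)) haM)
    rw [← h1, ← h2]
    exact (hxy i (by omega)).1

lemma Tower.hE_eq (h : Tower μ S m G κ0 D j n M) {α : Z → ι} (hα : FM α) {N : ι → ℕ}
    (hN : ∀ z, n z = N (α z)) (hM : 0 < M) : hE μ S (lift h α) = κ0.toReal * hE m G α := by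
  have t1 := tendsto_dE h.hS (h.lift_FM hα)
  have t2 := (tendsto_dE h.hG hα).const_mul κ0.toReal
  have hmul : Tendsto (fun l : ℕ => l * M) atTop atTop := tendsto_id.atTop_mul_const' hM
  apply le_antisymm
  · refine le_of_tendsto_of_tendsto (t1.comp hmul) t2 ?_
    filter_upwards [eventually_gt_atTop 0] with l hl
    exact (h.dE_bounds hα hN (Nat.mul_pos hl hM) le_rfl).2
  · refine le_of_tendsto_of_tendsto t2 t1 ?_
    filter_upwards [eventually_gt_atTop 0] with l hl
    exact (h.dE_bounds hα hN hl (q := 0) (by simp)).1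

lemma FM_bdd {n : Z → ℕ} (hn : Measurable n) (hnM : ∀ z, n z < M) :
    FM (fun z => (⟨n z, hnM z⟩ : Fin M)) := by
  intro i
  have : (fun z => (⟨n z, hnM z⟩ : Fin M)) ⁻¹' {i} = n ⁻¹' {(i : ℕ)} := by
    ext y; simp [Fin.ext_iff]
  rw [this]
  exact hn (measurableSet_singleton _)

/-- Abramov's formula for towers. -/
lemma Tower.kol_eq (h : Tower μ S m G κ0 D j n M) (hM : 0 < M) (hκ : κ0 ≠ ⊤) (hκ0 : κ0 ≠ 0)
    (e : ℕ → Z → Y) (he : ∀ i, Measurable (e i)) (hej : ∀ y, e (j y) (D y) = y) :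
    kolSinaiEntropy μ S = κ0 * kolSinaiEntropy m G := by
  have hn := FM_bdd h.hn h.hnM
  apply le_antisymm
  · refine kol_le fun k β hβ => ?_
    let α := pr (fun z => (⟨n z, h.hnM z⟩ : Fin M)) (fun z (i : Fin M) => β (e i z))
    have hα : FM α := hn.pr (FM.pi (f := fun (i : Fin M) z => β (e i z))
      fun i => hβ.of_comp (he i))
    have h1 := h.hE_eq hα (N := fun p => p.1) (fun z => rfl) hM
    have h2 : hE μ S β ≤ hE μ S (lift h α) := by
      refine hE_mono h.hS hβ (h.lift_FM hα) (det_of ?_)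
      intro x y hxy
      rw [h.lift_eq] at hxy
      obtain ⟨a, b⟩ := hxy
      have := congrFun (congrArg Prod.snd a) ⟨j x, h.hjM x⟩
      simp only [α, pr] at this
      rw [hej x, b, hej y] at this
      exact this
    rw [h1] at h2
    refine (ENNReal.ofReal_le_ofReal h2).trans ?_
    rw [ENNReal.ofReal_mul ENNReal.toReal_nonneg, ENNReal.ofReal_toReal hκ]
    gcongr
    exact le_kol hα
  · rw [mul_comm, ← ENNReal.le_div_iff_mul_le (Or.inl hκ0) (Or.inl hκ)]
    refine kol_le fun k f hf => ?_
    rw [ENNReal.le_div_iff_mul_le (Or.inl hκ0) (Or.inl hκ), mul_comm]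
    let α := pr (fun z => (⟨n z, h.hnM z⟩ : Fin M)) f
    have hα : FM α := hn.pr hf
    have h1 := h.hE_eq hα (N := fun p => p.1) (fun z => rfl) hM
    have h2 : hE m G f ≤ hE m G α :=
      hE_mono h.hG hf hα (det_of fun x y hxy => congrArg Prod.snd hxy)
    refine le_trans ?_ (le_kol (μ := μ) (T := S) (h.lift_FM hα))
    rw [h1, ENNReal.ofReal_mul ENNReal.toReal_nonneg, ENNReal.ofReal_toReal hκ]
    gcongr

end tower

end Abr

set_option linter.unusedSectionVars false
set_option linter.unusedVariables false

namespace Abr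
open Filter Topology

section approx
variable {X W : Type*} [MeasurableSpace X] [MeasurableSpace W]

/-- The algebra of sets determined by finitely many measurable labels on each factor. -/
def recAlg (X W : Type*) [MeasurableSpace X] [MeasurableSpace W] : Set (Set (X × W)) :=
  {s | ∃ (ι κ : Type) (_ : Fintype ι) (_ : Fintype κ) (p : X → ι) (q : W → κ) (φ : Set (ι × κ)),
    FM p ∧ FM q ∧ s = {z | (p z.1, q z.2) ∈ φ}}

lemma recAlg_isSetAlgebra : IsSetAlgebra (recAlg X W) where
  empty_mem := ⟨Unit, Unit, inferInstance, inferInstance, fun _ => (), fun _ => (), ∅,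
    fun i => by simp, fun i => by simp, by simp⟩
  compl_mem := by
    rintro s ⟨ι, κ, _, _, p, q, φ, hp, hq, rfl⟩
    exact ⟨ι, κ, inferInstance, inferInstance, p, q, φᶜ, hp, hq, rfl⟩
  union_mem := by
    rintro s t ⟨ι, κ, _, _, p, q, φ, hp, hq, rfl⟩ ⟨ι', κ', _, _, p', q', φ', hp', hq', rfl⟩
    refine ⟨ι × ι', κ × κ', inferInstance, inferInstance, pr p p', pr q q',
      {u | (u.1.1, u.2.1) ∈ φ ∨ (u.1.2, u.2.2) ∈ φ'}, hp.pr hp', hq.pr hq', ?_⟩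
    ext z; simp [pr]

lemma FM_mem {s : Set X} (hs : MeasurableSet s) : FM (fun x => (x ∈ s : Prop)) := by
  intro i
  by_cases h : i
  · have : (fun x => (x ∈ s : Prop)) ⁻¹' {i} = s := by ext x; simp [h]
    rw [this]; exact hs
  · have : (fun x => (x ∈ s : Prop)) ⁻¹' {i} = sᶜ := by ext x; simp [h]
    rw [this]; exact hs.compl

lemma recAlg_gen : (inferInstance : MeasurableSpace (X × W)) =
    MeasurableSpace.generateFrom (recAlg X W) := by
  apply le_antisymm
  · show Prod.instMeasurableSpace ≤ _
    rw [← generateFrom_prod]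
    apply MeasurableSpace.generateFrom_mono
    rintro _ ⟨s, hs, t, ht, rfl⟩
    refine ⟨Prop, Prop, inferInstance, inferInstance, fun x => x ∈ s, fun x => x ∈ t,
      {u | u.1 ∧ u.2}, FM_mem hs, FM_mem ht, ?_⟩
    ext z; simp
  · apply MeasurableSpace.generateFrom_le
    rintro s ⟨ι, κ, _, _, p, q, φ, hp, hq, rfl⟩
    exact ((hp.of_comp measurable_fst).pr (hq.of_comp measurable_snd)).set φ

lemma approx_prod (m : Measure (X × W)) [IsProbabilityMeasure m] {k : ℕ} {α : X × W → Fin k}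
    (hα : FM α) {δ : ℝ} (hδ : 0 < δ) :
    ∃ (ι κ : Type) (_ : Fintype ι) (_ : Fintype κ) (p : X → ι) (q : W → κ), FM p ∧ FM q ∧
      cH m α (fun z => (p z.1, q z.2)) ≤ δ := by
  classical
  obtain ⟨η, hη, hF⟩ := fano (Fin k) hδ
  have hk : 0 < k := by
    obtain ⟨z⟩ : Nonempty (X × W) := nonempty_of_isProbabilityMeasure m
    exact (α z).pos
  have hd := Measure.MeasureDense.of_generateFrom_isSetAlgebra_finite m
    (recAlg_isSetAlgebra (X := X) (W := W)) recAlg_gen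
  have hk' : (0 : ℝ) < η / (2 * k) := by positivity
  have := fun i => hd.approx _ (hα i) (measure_ne_top _ _) (η / (2 * k)) hk'
  choose A hA hlt using this
  choose ι κ fι fκ p q φ hp hq hAe using hA
  let P : X → ∀ i, ι i := fun x i => p i x
  let Q : W → ∀ i, κ i := fun x i => q i x
  have hP : FM P := FM.pi hp
  have hQ : FM Q := FM.pi hq
  refine ⟨∀ i, ι i, ∀ i, κ i, inferInstance, inferInstance, P, Q, hP, hQ, ?_⟩
  let PQ : X × W → (∀ i, ι i) × (∀ i, κ i) := fun z => (P z.1, Q z.2)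
  have hPQ : FM PQ := (hP.of_comp measurable_fst).pr (hQ.of_comp measurable_snd)
  let ψ : (∀ i, ι i) × (∀ i, κ i) → Fin k := fun u =>
    if h : ∃ i, (u.1 i, u.2 i) ∈ φ i then h.choose else ⟨0, hk⟩
  refine (cH_anti hα hPQ (hPQ.comp ψ) (det_of fun x y h => by rw [h])).trans ?_
  apply hF _ _ _ hα (hPQ.comp ψ)
  have hsub : {z | α z ≠ ψ (PQ z)} ⊆ ⋃ i ∈ (Finset.univ : Finset (Fin k)),
      symmDiff (α ⁻¹' {i}) (A i) := by
    intro z hz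
    by_contra hcon
    apply hz
    have hc : ∀ i, (α z = i ↔ (p i z.1, q i z.2) ∈ φ i) := by
      intro i
      simp only [Finset.mem_univ, iUnion_true, mem_iUnion, not_exists] at hcon
      have := hcon i
      rw [Set.mem_symmDiff, hAe i] at this
      simp only [mem_preimage, mem_singleton_iff, mem_setOf_eq] at this
      tauto
    have hex : ∃ i, ((PQ z).1 i, (PQ z).2 i) ∈ φ i := ⟨α z, (hc _).1 rfl⟩
    simp only [ψ]
    rw [dif_pos hex]
    exact (hc _).2 hex.choose_spec
  have hle : m.real {z | α z ≠ ψ (PQ z)} ≤ ∑ i : Fin k, η / (2 * k) := by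
    refine (measureReal_mono hsub (measure_ne_top _ _)).trans ?_
    refine (measureReal_biUnion_finset_le _ _).trans ?_
    refine Finset.sum_le_sum fun i _ => ?_
    rw [measureReal_def]
    exact ENNReal.toReal_le_of_le_ofReal hk'.le (hlt i).le
  refine hle.trans_lt ?_
  simp only [Finset.sum_const, Finset.card_univ, Fintype.card_fin, nsmul_eq_mul]
  have : (k : ℝ) ≠ 0 := by positivity
  field_simp
  linarith

end approx

end Abr

set_option linter.unusedSectionVars false
set_option linter.unusedVariables false

namespace Abr
open Filter Topology

section skew
variable {X : Type*} {W : Type} [MeasurableSpace X] [MeasurableSpace W]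
  [AddCommGroup W] [TopologicalSpace W] [IsTopologicalAddGroup W] [CompactSpace W] [BorelSpace W]
  [MeasurableAdd₂ W] {lam : Measure W} [IsProbabilityMeasure lam] [lam.InnerRegularCompactLTTop]
  [lam.IsAddLeftInvariant] {κ : Type} [Fintype κ]

lemma FM.ne_meas {ι : Type} [Fintype ι] {f g : X → ι} (hf : FM f) (hg : FM g) :
    MeasurableSet {x | f x ≠ g x} := (hf.pr hg).set {u | u.1 ≠ u.2}

lemma net0 {q : W → κ} (hq : FM q) {η : ℝ} (hη : 0 < η) :
    ∀ᶠ g in 𝓝 (0 : W), lam.real {w | q (w + g) ≠ q w} < η := by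
  classical
  let F : C(W, C(W, W)) := ContinuousMap.curry ⟨fun p : W × W => p.2 + p.1, by fun_prop⟩
  have hF : ∀ g w, F g w = w + g := fun g w => rfl
  have hmp : ∀ g, MeasurePreserving (F g) lam lam := fun g => by
    have := measurePreserving_add_right lam g
    exact this
  have h1 : ∀ i : κ, Tendsto (fun g => lam (symmDiff (F g ⁻¹' (q ⁻¹' {i})) (F 0 ⁻¹' (q ⁻¹' {i}))))
      (𝓝 0) (𝓝 0) := fun i =>
    tendsto_measure_symmDiff_preimage_nhds_zero (F.continuous.tendsto 0)
      (Eventually.of_forall hmp) (hmp 0) (hq i).nullMeasurableSet (measure_ne_top _ _)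
  have h2 := tendsto_finsetSum (Finset.univ : Finset κ) fun i _ => h1 i
  simp only [Finset.sum_const_zero] at h2
  have h3 : ∀ᶠ x in 𝓝 (0 : ℝ≥0∞), x < ENNReal.ofReal η :=
    gt_mem_nhds (by simpa using hη)
  filter_upwards [h2.eventually h3] with g hg
  have hsub : {w | q (w + g) ≠ q w} ⊆ ⋃ i ∈ (Finset.univ : Finset κ),
      symmDiff (F g ⁻¹' (q ⁻¹' {i})) (F 0 ⁻¹' (q ⁻¹' {i})) := by
    intro w hw
    simp only [Finset.mem_univ, iUnion_true, mem_iUnion]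
    refine ⟨q w, ?_⟩
    rw [Set.mem_symmDiff]
    right
    simp only [mem_preimage, hF, add_zero, mem_singleton_iff]
    exact ⟨trivial, hw⟩
  rw [measureReal_def]
  refine (ENNReal.toReal_lt_of_lt_ofReal ?_)
  exact ((measure_mono hsub).trans (measure_biUnion_finset_le _ _)).trans_lt hg

lemma net {q : W → κ} (hq : FM q) {η : ℝ} (hη : 0 < η) :
    ∃ (R : Type) (_ : Fintype R) (gs : R → W) (idx : W → R), FM idx ∧
      ∀ g, lam.real {w | q (w + g) ≠ q (w + gs (idx g))} < η := by
  classical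
  obtain ⟨U, hU, hUo, h0⟩ := eventually_nhds_iff.1 (net0 (lam := lam) hq hη)
  obtain ⟨t, ht⟩ := isCompact_univ.elim_finite_subcover (fun h : W => {g | g - h ∈ U})
    (fun h => hUo.preimage (by fun_prop)) (fun g _ => by
      simp only [mem_iUnion]; exact ⟨g, by simpa using h0⟩)
  have hcov : ∀ g : W, ∃ i : t, g - (i : W) ∈ U := by
    intro g
    have := ht (mem_univ g)
    simp only [mem_iUnion] at this
    obtain ⟨i, hi, h⟩ := this
    exact ⟨⟨i, hi⟩, h⟩
  let J : W → (t → Prop) := fun g i => g - (i : W) ∈ U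
  have hJ : FM J := FM.pi (f := fun (i : t) (g : W) => (g - (i : W) ∈ U : Prop)) fun i => by
    have hc : Continuous (fun g : W => g - (i : W)) := by fun_prop
    exact FM_mem (s := {g : W | g - (i : W) ∈ U}) (hUo.preimage hc).measurableSet
  let i0 : t := (hcov 0).choose
  let ψ : (t → Prop) → t := fun u => if h : ∃ i, u i then h.choose else i0
  refine ⟨t, inferInstance, fun i => i, fun g => ψ (J g), hJ.comp ψ, fun g => ?_⟩
  have hmem : g - (ψ (J g) : W) ∈ U := by
    have : ∃ i, J g i := hcov g
    simp only [ψ]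
    rw [dif_pos this]
    exact this.choose_spec
  show lam.real {w | q (w + g) ≠ q (w + ((ψ (J g) : t) : W))} < η
  generalize ((ψ (J g) : t) : W) = h at hmem ⊢
  have h1 := hU _ hmem
  have h2 := measurePreserving_add_right lam h
  have hm : MeasurableSet {w | q (w + (g - h)) ≠ q w} :=
    FM.ne_meas (hq.of_comp (measurable_add_const _)) hq
  have h3 := h2.measureReal_preimage hm.nullMeasurableSet
  rw [← h3] at h1
  convert h1 using 3
  ext w
  simp only [mem_setOf_eq, mem_preimage]
  rw [show w + h + (g - h) = w + g by abel]

/-- Birkhoff sums of the cocycle. -/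
def rs (T : X → X) (ρ : X → W) : ℕ → X → W
  | 0, _ => 0
  | n + 1, x => ρ x + rs T ρ n (T x)

lemma rs_meas {T : X → X} (hT : Measurable T) {ρ : X → W} (hρ : Measurable ρ) (n : ℕ) :
    Measurable (rs T ρ n) := by
  induction n with
  | zero => exact measurable_const
  | succ n ih => exact hρ.add (ih.comp hT)

/-- The skew product. -/
def skw (T : X → X) (ρ : X → W) : X × W → X × W := fun z => (T z.1, z.2 + ρ z.1)

lemma skw_iter (T : X → X) (ρ : X → W) (n : ℕ) (z : X × W) :
    (skw T ρ)^[n] z = (T^[n] z.1, z.2 + rs T ρ n z.1) := by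
  induction n generalizing z with
  | zero => simp [rs]
  | succ n ih => 
    rw [Function.iterate_succ_apply, ih]
    simp [skw, rs, add_assoc]

variable {ν : Measure X} [IsProbabilityMeasure ν]

lemma skw_mp {T : X → X} (hT : MeasurePreserving T ν ν) {ρ : X → W} (hρ : Measurable ρ) :
    MeasurePreserving (skw T ρ) (ν.prod lam) (ν.prod lam) := by
  refine MeasurePreserving.skew_product (g := fun x w => w + ρ x) hT ?_ ?_
  · exact measurable_snd.add (hρ.comp measurable_fst)
  · exact Eventually.of_forall fun x => (measurePreserving_add_right lam (ρ x)).map_eq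

lemma skew_hE {T : X → X} (hT : MeasurePreserving T ν ν) {ρ : X → W} (hρ : Measurable ρ)
    {ι : Type} [Fintype ι] {p : X → ι} (hp : FM p) {q : W → κ} (hq : FM q) {δ : ℝ} (hδ : 0 < δ) :
    ∃ (ζ : Type) (_ : Fintype ζ) (P : X → ζ), FM P ∧
      hE (ν.prod lam) (skw T ρ) (fun z => (p z.1, q z.2)) ≤ hE ν T P + δ := by
  classical
  obtain ⟨η, hη, hFano⟩ := fano (ι × κ) (half_pos hδ)
  obtain ⟨R, _, gs, idx, hidx, hnet⟩ := net (lam := lam) hq (half_pos hη)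
  set m := ν.prod lam with hm
  have hG : MeasurePreserving (skw T ρ) m m := skw_mp hT hρ
  let K : X × W → (R → κ) := fun z i => q (z.2 + gs i)
  have hK : FM K := FM.pi (f := fun i (z : X × W) => q (z.2 + gs i)) fun i =>
    hq.of_comp (measurable_snd.add_const _)
  obtain ⟨b, hb⟩ := exists_nat_gt (H m K / (δ / 2))
  have hb1 : H m K ≤ (b + 1 : ℕ) * (δ / 2) := by
    rw [div_lt_iff₀ (by positivity)] at hb
    push_cast
    nlinarith
  obtain ⟨B, hB0, hB⟩ : ∃ B : ℕ, 0 < B ∧ H m K ≤ B * (δ / 2) := ⟨b + 1, by omega, hb1⟩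
  let P : X → ι × (Fin B → R) := fun x => (p x, fun k => idx (rs T ρ k x))
  have hP : FM P := hp.pr (FM.pi (f := fun (k : Fin B) x => idx (rs T ρ k x)) fun k =>
    hidx.of_comp (rs_meas hT.measurable hρ k))
  refine ⟨ι × (Fin B → R), inferInstance, P, hP, ?_⟩
  let α : X × W → ι × κ := fun z => (p z.1, q z.2)
  have hα : FM α := (hp.of_comp measurable_fst).pr (hq.of_comp measurable_snd)
  let Pf : X × W → ι × (Fin B → R) := fun z => P z.1
  have hPf : FM Pf := hP.of_comp measurable_fst
  have e1 := hE_pow hG hα hB0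
  have e2 := hE_pow hG hPf hB0
  have e3 : hE m (skw T ρ) Pf = hE ν T P :=
    hE_factor (π := Prod.fst) measurePreserving_fst hT.measurable (fun z => rfl) hP
  have hαb := hα.blk hG.measurable B
  have hPb := hPf.blk hG.measurable B
  have e4 := hE_le_add (hG.iterate B) hαb hPb
  have e5 : cH m (blk (skw T ρ) α B) (blk (skw T ρ) Pf B) ≤ B * δ := by
    calc _ ≤ cH m (pr (blk (skw T ρ) α B) K) (blk (skw T ρ) Pf B) :=
          cH_mono_left hαb (hαb.pr hK) hPb (det_of fun x y h => congrArg Prod.fst h)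
      _ = cH m (blk (skw T ρ) α B) (pr K (blk (skw T ρ) Pf B)) + cH m K (blk (skw T ρ) Pf B) :=
          cH_chain
      _ ≤ (∑ k : Fin B, cH m (fun z => α ((skw T ρ)^[k] z)) (pr K (blk (skw T ρ) Pf B))) + H m K :=
          add_le_add (cH_pi_le (f := fun (k : Fin B) z => α ((skw T ρ)^[k] z))
            (fun k => hα.iter hG.measurable k) (hK.pr hPb)) (cH_le_H hK hPb)
      _ ≤ (∑ k : Fin B, δ / 2) + B * (δ / 2) := by
          refine add_le_add (Finset.sum_le_sum fun k _ => ?_) hB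
          let gu : X × W → ι × κ := fun z => (p (T^[k] z.1), q (z.2 + gs (idx (rs T ρ k z.1))))
          have hgu : FM gu := by
            refine (hp.of_comp ((hT.measurable.iterate k).comp measurable_fst)).pr ?_
            have : FM (pr K (fun z : X × W => idx (rs T ρ k z.1))) :=
              hK.pr (hidx.of_comp ((rs_meas hT.measurable hρ k).comp measurable_fst))
            exact this.comp (fun u => u.1 u.2)
          refine (cH_anti (hα.iter hG.measurable k) (hK.pr hPb) hgu (det_of ?_)).trans ?_
          · intro x y h
            simp only [pr, Prod.mk.injEq, blk_eq_iff] at h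
            obtain ⟨h1, h2⟩ := h
            have h3 := h2 0 hB0
            have h4 := h2 k k.2
            simp only [Pf, P, skw_iter, Prod.mk.injEq] at h3 h4
            have h5 := congrFun h3.2 k
            simp only [Function.iterate_zero, id] at h5
            have h6 := congrFun h1 (idx (rs T ρ k y.1))
            simp only [K] at h6
            simp only [gu, Prod.mk.injEq]
            exact ⟨h4.1, by rw [h5]; exact h6⟩
          · apply hFano _ _ _ (hα.iter hG.measurable k) hgu
            have hms := FM.ne_meas (hα.iter hG.measurable k) hgu
            refine lt_of_le_of_lt ?_ (half_lt_self hη)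
            rw [measureReal_def]
            refine ENNReal.toReal_le_of_le_ofReal (half_pos hη).le ?_
            rw [hm, Measure.prod_apply hms]
            calc _ ≤ ∫⁻ x, ENNReal.ofReal (η / 2) ∂ν := by
                  refine lintegral_mono fun x => ?_
                  have := hnet (rs T ρ k x)
                  have h7 : (Prod.mk x ⁻¹' {z | α ((skw T ρ)^[k] z) ≠ gu z}) =
                      {w | q (w + rs T ρ k x) ≠ q (w + gs (idx (rs T ρ k x)))} := by
                    ext w
                    simp [α, gu, skw_iter]
                  rw [h7, ← ENNReal.ofReal_toReal (measure_ne_top lam _)]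
                  exact ENNReal.ofReal_le_ofReal this.le
              _ = _ := by simp
      _ = B * δ := by simp; ring
  rw [e1, e2, e3] at e4
  have hBp : (0 : ℝ) < B := by exact_mod_cast hB0
  have : B * hE m (skw T ρ) α ≤ B * (hE ν T P + δ) := by linarith
  exact le_of_mul_le_mul_left this hBp

lemma kol_skew {T : X → X} (hT : MeasurePreserving T ν ν) {ρ : X → W} (hρ : Measurable ρ) :
    kolSinaiEntropy (ν.prod lam) (skw T ρ) = kolSinaiEntropy ν T := by
  apply le_antisymm
  · refine kol_le fun k α hα => ?_
    refine ENNReal.le_of_forall_pos_le_add fun ε hε hfin => ?_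
    have hε' : (0 : ℝ) < ε / 2 := by positivity
    obtain ⟨ι, κ, _, _, p, q, hp, hq, h1⟩ := approx_prod (ν.prod lam) hα hε'
    obtain ⟨ζ, _, P, hP, h2⟩ := skew_hE (lam := lam) hT hρ hp hq hε'
    have hpq : FM (fun z : X × W => (p z.1, q z.2)) :=
      (hp.of_comp measurable_fst).pr (hq.of_comp measurable_snd)
    have h3 := hE_le_add (skw_mp (lam := lam) hT hρ) hα hpq
    have h4 : hE (ν.prod lam) (skw T ρ) α ≤ hE ν T P + ε := by linarith
    refine (ENNReal.ofReal_le_ofReal h4).trans ?_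
    rw [ENNReal.ofReal_add (hE_nonneg hT hP) ε.coe_nonneg]
    gcongr
    · exact le_kol hP
    · simp
  · exact kol_factor_le (π := Prod.fst) measurePreserving_fst hT.measurable (fun z => rfl)

end skew

end Abr

set_option linter.unusedSectionVars false
set_option linter.unusedVariables false

namespace Abr
open Filter Topology

section flow
variable {X : Type*} [MeasurableSpace X]

/-- The suspension flow data over an invertible base. -/
structure SF (T : X ≃ᵐ X) (r : X → ℝ) (c C : ℝ) (Φ : ℝ → Susp r → Susp r) : Prop where
  hc : 0 < c
  hr : Measurable r
  hb : ∀ x, c ≤ r x ∧ r x ≤ C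
  h0 : ∀ q, Φ 0 q = q
  hadd : ∀ s t q, Φ (s + t) q = Φ s (Φ t q)
  hchar : ∀ t : ℝ, 0 ≤ t → ∀ q : Susp r, ∃ n : ℕ,
      birkhoff T r n q.val.1 ≤ q.val.2 + t ∧
      q.val.2 + t < birkhoff T r (n + 1) q.val.1 ∧
      (Φ t q).val.1 = T^[n] q.val.1 ∧
      (Φ t q).val.2 = q.val.2 + t - birkhoff T r n q.val.1

variable {T : X ≃ᵐ X} {r : X → ℝ} {c C : ℝ} {Φ : ℝ → Susp r → Susp r}

namespace SF

lemma birk_nonneg (h : SF T r c C Φ) (n : ℕ) (x : X) : 0 ≤ birkhoff T r n x := by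
  induction n generalizing x with
  | zero => simp [birkhoff]
  | succ n ih => simp only [birkhoff]; linarith [ih (T x), h.hc, (h.hb x).1]

lemma neg_cancel (h : SF T r c C Φ) (t : ℝ) (q : Susp r) : Φ (-t) (Φ t q) = q := by
  rw [← h.hadd, neg_add_cancel, h.h0]

lemma cancel_neg (h : SF T r c C Φ) (t : ℝ) (q : Susp r) : Φ t (Φ (-t) q) = q := by
  rw [← h.hadd, add_neg_cancel, h.h0]

lemma up0 (h : SF T r c C Φ) {t : ℝ} (ht : 0 ≤ t) (q : Susp r) (hq : q.val.2 + t < r q.val.1) :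
    (Φ t q).val = (q.val.1, q.val.2 + t) := by
  obtain ⟨n, h1, h2, h3, h4⟩ := h.hchar t ht q
  rcases n with _ | n
  · ext
    · simpa using h3
    · simpa [birkhoff] using h4
  · simp only [birkhoff] at h1
    linarith [h.birk_nonneg n (T q.val.1)]

lemma up1 (h : SF T r c C Φ) {t : ℝ} (ht : 0 ≤ t) (htc : t ≤ c) (q : Susp r)
    (hq : r q.val.1 ≤ q.val.2 + t) :
    (Φ t q).val = (T q.val.1, q.val.2 + t - r q.val.1) := by
  obtain ⟨n, h1, h2, h3, h4⟩ := h.hchar t ht q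
  rcases n with _ | _ | n
  · simp [birkhoff] at h2; linarith
  · ext
    · simpa using h3
    · simpa [birkhoff] using h4
  · simp only [birkhoff] at h1
    linarith [h.birk_nonneg n (T (T q.val.1)), (h.hb (T q.val.1)).1, q.2.2]

/-- Moving inside one fibre, either direction. -/
lemma fib (h : SF T r c C Φ) (t : ℝ) (q : Susp r) (h0 : 0 ≤ q.val.2 + t)
    (hq : q.val.2 + t < r q.val.1) : (Φ t q).val = (q.val.1, q.val.2 + t) := by
  rcases le_total 0 t with ht | ht
  · exact h.up0 ht q hq
  · let q' : Susp r := ⟨(q.val.1, q.val.2 + t), h0, hq⟩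
    have : Φ (-t) q' = q := by
      apply Subtype.ext
      rw [h.up0 (by linarith) q' (by simpa [q'] using q.2.2)]
      ext <;> simp [q']
    conv_lhs => rw [← this, h.cancel_neg]

lemma down1 (h : SF T r c C Φ) {t : ℝ} (ht : 0 ≤ t) (htc : t ≤ c) (q : Susp r)
    (hq : q.val.2 < t) :
    (Φ (-t) q).val = (T.symm q.val.1, q.val.2 - t + r (T.symm q.val.1)) := by
  have hb := h.hb (T.symm q.val.1)
  let q' : Susp r := ⟨(T.symm q.val.1, q.val.2 - t + r (T.symm q.val.1)), by
    have := q.2.1; simp only; linarith [hb.1], by simp only; linarith⟩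
  have : Φ t q' = q := by
    apply Subtype.ext
    rw [h.up1 ht htc q' (by have := q.2.1; simp only [q']; linarith)]
    ext
    · simp [q']
    · simp only [q']; ring
  conv_lhs => rw [← this, h.neg_cancel]

lemma iter (h : SF T r c C Φ) (t : ℝ) (n : ℕ) (q : Susp r) : (Φ t)^[n] q = Φ (n * t) q := by
  induction n generalizing q with
  | zero => simp [h.h0]
  | succ n ih =>
    rw [Function.iterate_succ_apply, ih, ← h.hadd]
    congr 1; push_cast; ring

lemma meas_pos (h : SF T r c C Φ) {t : ℝ} (ht : 0 ≤ t) (htc : t ≤ c) : Measurable (Φ t) := by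
  have hx : Measurable fun q : Susp r => q.val.1 := measurable_fst.comp measurable_subtype_coe
  have hs : Measurable fun q : Susp r => q.val.2 := measurable_snd.comp measurable_subtype_coe
  have hrx : Measurable fun q : Susp r => r q.val.1 := h.hr.comp hx
  have : Measurable fun q => (Φ t q).val := by
    have e : (fun q => (Φ t q).val) = fun q => if q.val.2 + t < r q.val.1 then
        (q.val.1, q.val.2 + t) else (T q.val.1, q.val.2 + t - r q.val.1) := by
      funext q
      split_ifs with hq
      · exact h.up0 ht q hq
      · exact h.up1 ht htc q (not_lt.1 hq)
    rw [e]
    refine Measurable.ite (measurableSet_lt (hs.add_const t) hrx) (hx.prodMk (hs.add_const t)) ?_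
    exact (T.measurable.comp hx).prodMk ((hs.add_const t).sub hrx)
  exact this.subtype_mk (h := fun q => (Φ t q).2)

lemma meas_neg (h : SF T r c C Φ) {t : ℝ} (ht : 0 ≤ t) (htc : t ≤ c) : Measurable (Φ (-t)) := by
  have hx : Measurable fun q : Susp r => q.val.1 := measurable_fst.comp measurable_subtype_coe
  have hs : Measurable fun q : Susp r => q.val.2 := measurable_snd.comp measurable_subtype_coe
  have : Measurable fun q => (Φ (-t) q).val := by
    have e : (fun q => (Φ (-t) q).val) = fun q => if q.val.2 < t then
        (T.symm q.val.1, q.val.2 - t + r (T.symm q.val.1)) else (q.val.1, q.val.2 - t) := by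
      funext q
      split_ifs with hq
      · exact h.down1 ht htc q hq
      · exact h.fib (-t) q (by linarith) (by linarith [q.2.2])
    rw [e]
    refine Measurable.ite (measurableSet_lt hs measurable_const) ?_ (hx.prodMk (hs.sub_const t))
    exact (T.symm.measurable.comp hx).prodMk
      ((hs.sub_const t).add (h.hr.comp (T.symm.measurable.comp hx)))
  exact this.subtype_mk (h := fun q => (Φ (-t) q).2)

/-- Every nonnegative time is a multiple of a small time. -/
lemma small (h : SF T r c C Φ) (t : ℝ) (ht : 0 ≤ t) : ∃ (n : ℕ) (u : ℝ), 0 ≤ u ∧ u ≤ c ∧ n * u = t := by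
  obtain ⟨n, hn⟩ := exists_nat_gt (t / c)
  have hc := h.hc
  have hn0 : (0 : ℝ) < n := lt_of_le_of_lt (by positivity) hn
  refine ⟨n, t / n, by positivity, ?_, by field_simp⟩
  rw [div_lt_iff₀ hc] at hn
  rw [div_le_iff₀ hn0]
  linarith

lemma meas (h : SF T r c C Φ) (t : ℝ) : Measurable (Φ t) := by
  rcases le_total 0 t with ht | ht
  · obtain ⟨n, u, hu0, huc, rfl⟩ := h.small t ht
    have := (h.meas_pos hu0 huc).iterate n
    exact (funext (h.iter u n) : (Φ u)^[n] = Φ (n * u)) ▸ this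
  · obtain ⟨n, u, hu0, huc, hu⟩ := h.small (-t) (by linarith)
    have := (h.meas_neg hu0 huc).iterate n
    have e : (n : ℝ) * -u = t := by linarith
    rw [← e]
    exact (funext (h.iter (-u) n) : (Φ (-u))^[n] = Φ (n * -u)) ▸ this

/-- The flow as measurable equivalences. -/
def equiv (h : SF T r c C Φ) (t : ℝ) : Susp r ≃ᵐ Susp r where
  toFun := Φ t
  invFun := Φ (-t)
  left_inv := h.neg_cancel t
  right_inv := h.cancel_neg t
  measurable_toFun := h.meas t
  measurable_invFun := h.meas (-t)

lemma flowInv_of_small (h : SF T r c C Φ) {μ : Measure (Susp r)}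
    (hμ : ∀ t, 0 ≤ t → t ≤ c → MeasurePreserving (Φ t) μ μ) : FlowInvariant Φ μ := by
  have hpos : ∀ t, 0 ≤ t → MeasurePreserving (Φ t) μ μ := by
    intro t ht
    obtain ⟨n, u, hu0, huc, rfl⟩ := h.small t ht
    have := (hμ u hu0 huc).iterate n
    exact (funext (h.iter u n) : (Φ u)^[n] = Φ (n * u)) ▸ this
  intro t
  rcases le_total 0 t with ht | ht
  · exact hpos t ht
  · have h1 : MeasurePreserving (h.equiv (-t)) μ μ := hpos (-t) (by linarith)
    have h2 := h1.symm
    have e : ((h.equiv (-t)).symm : Susp r → Susp r) = Φ t := by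
      show Φ (- -t) = Φ t
      rw [neg_neg]
    rwa [e] at h2

end SF

/-! Suspension measures. -/

/-- Unnormalized suspension measure. -/
noncomputable def sus (ν : Measure X) (r : X → ℝ) : Measure (Susp r) :=
  Measure.comap (Subtype.val : Susp r → X × ℝ) (ν.prod volume)

lemma region_meas (hr : Measurable r) : MeasurableSet {p : X × ℝ | 0 ≤ p.2 ∧ p.2 < r p.1} :=
  (measurableSet_le measurable_const measurable_snd).inter
    (measurableSet_lt measurable_snd (hr.comp measurable_fst))

lemma sus_lintegral (hr : Measurable r) (ν : Measure X) [SFinite ν] {f : X × ℝ → ℝ≥0∞}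
    (hf : Measurable f) :
    ∫⁻ q, f q.val ∂(sus ν r) = ∫⁻ x, (∫⁻ u in Ico 0 (r x), f (x, u)) ∂ν := by
  have hR := region_meas hr
  unfold sus
  refine (lintegral_subtype_comap hR f).trans ?_
  rw [← lintegral_indicator hR,
    lintegral_prod _ (hf.indicator hR).aemeasurable]
  refine lintegral_congr fun x => ?_
  rw [← lintegral_indicator measurableSet_Ico]
  rfl

lemma sus_apply (hr : Measurable r) (ν : Measure X) [SFinite ν] {E : Set (X × ℝ)}
    (hE : MeasurableSet E) :
    sus ν r (Subtype.val ⁻¹' E) = ∫⁻ x, (∫⁻ u in Ico 0 (r x), E.indicator 1 (x, u)) ∂ν := by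
  rw [← sus_lintegral hr ν (measurable_one.indicator hE),
    ← lintegral_indicator_one (measurable_subtype_coe hE)]
  rfl

lemma sus_base (hr : Measurable r) (ν : Measure X) [SFinite ν] {S : Set X}
    (hS : MeasurableSet S) :
    sus ν r {q | q.val.1 ∈ S} = ∫⁻ x in S, ENNReal.ofReal (r x) ∂ν := by
  have := sus_apply hr ν (E := {p | p.1 ∈ S}) (measurable_fst hS)
  rw [show {q : Susp r | q.val.1 ∈ S} = Subtype.val ⁻¹' {p : X × ℝ | p.1 ∈ S} from rfl, this,
    ← lintegral_indicator hS]
  refine lintegral_congr fun x => ?_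
  by_cases hx : x ∈ S
  · have : ∀ u : ℝ, ({p : X × ℝ | p.1 ∈ S}.indicator 1 (x, u) : ℝ≥0∞) = 1 := fun u => by
      simp [Set.indicator, hx]
    simp [hx]
  · have : ∀ u : ℝ, ({p : X × ℝ | p.1 ∈ S}.indicator 1 (x, u) : ℝ≥0∞) = 0 := fun u => by
      simp [Set.indicator, hx]
    simp [hx]

lemma ind_congr {α β : Type*} {E : Set α} {F : Set β} {p : α} {q : β} (h : p ∈ E ↔ q ∈ F) :
    (E.indicator 1 p : ℝ≥0∞) = F.indicator 1 q := by
  by_cases hp : p ∈ E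
  · rw [indicator_of_mem hp, indicator_of_mem (h.1 hp)]; rfl
  · rw [indicator_of_notMem hp, indicator_of_notMem (fun hq => hp (h.2 hq))]

lemma setLI_shift (f : ℝ → ℝ≥0∞) (a b t : ℝ) :
    ∫⁻ u in Ico a b, f (u + t) = ∫⁻ u in Ico (a + t) (b + t), f u := by
  have h := (measurePreserving_add_right (volume : Measure ℝ) t).setLIntegral_comp_preimage_emb
    (measurableEmbedding_addRight t) f (Ico (a + t) (b + t))
  rw [← h]
  congr 2
  ext u; simp

lemma setLI_split (f : ℝ → ℝ≥0∞) {a b c : ℝ} (h1 : a ≤ b) (h2 : b ≤ c) :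
    ∫⁻ u in Ico a c, f u = (∫⁻ u in Ico a b, f u) + ∫⁻ u in Ico b c, f u := by
  rw [← Ico_union_Ico_eq_Ico h1 h2, lintegral_union measurableSet_Ico]
  rw [Set.disjoint_left]
  intro x hx hx'
  exact absurd hx.2 (not_lt.2 hx'.1)

lemma SF.sus_inv (h : SF T r c C Φ) {ν : Measure X} [SFinite ν] (hν : MeasurePreserving T ν ν) :
    FlowInvariant Φ (sus ν r) := by
  refine h.flowInv_of_small fun t ht htc => ⟨h.meas t, ?_⟩
  ext E0 hE0
  obtain ⟨E, hE, rfl⟩ := hE0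
  rw [Measure.map_apply (h.meas t) (measurable_subtype_coe hE)]
  let E' : Set (X × ℝ) := {p | if p.2 + t < r p.1 then (p.1, p.2 + t) ∈ E else
    (T p.1, p.2 + t - r p.1) ∈ E}
  have hx : Measurable fun q : X × ℝ => q.1 := measurable_fst
  have hs : Measurable fun q : X × ℝ => q.2 := measurable_snd
  have hrx : Measurable fun q : X × ℝ => r q.1 := h.hr.comp hx
  have hE' : MeasurableSet E' := by
    have : Measurable fun p : X × ℝ => if p.2 + t < r p.1 then (p.1, p.2 + t) else
        (T p.1, p.2 + t - r p.1) := by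
      refine Measurable.ite (measurableSet_lt (hs.add_const t) hrx) (hx.prodMk (hs.add_const t)) ?_
      exact (T.measurable.comp hx).prodMk ((hs.add_const t).sub hrx)
    convert this hE using 1
    ext p
    simp only [E', mem_preimage, mem_setOf_eq]
    split_ifs <;> rfl
  have e : Φ t ⁻¹' (Subtype.val ⁻¹' E) = Subtype.val ⁻¹' E' := by
    ext q
    simp only [E', mem_preimage, mem_setOf_eq]
    split_ifs with hq
    · rw [h.up0 ht q hq]
    · rw [h.up1 ht htc q (not_lt.1 hq)]
  rw [e, sus_apply h.hr ν hE, sus_apply h.hr ν hE']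
  have hEi : Measurable (E.indicator (1 : X × ℝ → ℝ≥0∞)) := measurable_one.indicator hE
  have hpart : ∀ x, ∫⁻ u in Ico 0 (r x), E'.indicator 1 (x, u) =
      (∫⁻ u in Ico t (r x), E.indicator 1 (x, u)) + ∫⁻ u in Ico 0 t, E.indicator 1 (T x, u) := by
    intro x
    have hb := h.hb x
    rw [setLI_split (b := r x - t) _ (by linarith) (by linarith)]
    congr 1
    · rw [show Ico t (r x) = Ico (0 + t) (r x - t + t) by simp,
        ← setLI_shift (fun u => E.indicator 1 (x, u))]
      refine setLIntegral_congr_fun measurableSet_Ico fun u hu => ?_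
      have : u + t < r x := by linarith [hu.2]
      have hiff : (x, u) ∈ E' ↔ (x, u + t) ∈ E := by
        show (if u + t < r x then _ else _) ↔ _
        rw [if_pos this]
      exact ind_congr hiff
    · have := setLI_shift (fun u => E.indicator 1 (T x, u)) (r x - t) (r x) (t - r x)
      rw [show r x - t + (t - r x) = 0 by ring, show r x + (t - r x) = t by ring] at this
      rw [← this]
      refine setLIntegral_congr_fun measurableSet_Ico fun u hu => ?_
      have h1 : ¬ (u + t < r x) := by linarith [hu.1]
      have hiff : (x, u) ∈ E' ↔ (T x, u + (t - r x)) ∈ E := by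
        show (if u + t < r x then _ else _) ↔ _
        rw [if_neg h1, add_sub_assoc]
      exact ind_congr hiff
  simp_rw [hpart]
  have hm : Measurable fun x => ∫⁻ u in Ico 0 t, E.indicator (1 : X × ℝ → ℝ≥0∞) (x, u) :=
    hEi.lintegral_prod_right'
  have hm' : Measurable fun x => ∫⁻ u in Ico 0 t, E.indicator (1 : X × ℝ → ℝ≥0∞) (T x, u) :=
    hm.comp T.measurable
  rw [lintegral_add_right _ hm']
  have := hν.lintegral_comp hm
  rw [this, ← lintegral_add_right _ hm]
  refine lintegral_congr fun x => ?_
  rw [setLI_split _ ht (htc.trans (h.hb x).1), add_comm]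

end flow

end Abr

set_option linter.unusedSectionVars false
set_option linter.unusedVariables false

namespace Abr
open Filter Topology

section flow
variable {X : Type*} [MeasurableSpace X]
variable {T : X ≃ᵐ X} {r : X → ℝ} {c C : ℝ} {Φ : ℝ → Susp r → Susp r}

namespace SF

lemma cC (h : SF T r c C Φ) [Nonempty X] : c ≤ C := by
  obtain ⟨x⟩ := ‹Nonempty X›
  exact (h.hb x).1.trans (h.hb x).2

lemma r_int (h : SF T r c C Φ) (ν : Measure X) [IsFiniteMeasure ν] : Integrable r ν := by
  refine Integrable.of_bound h.hr.aestronglyMeasurable C (Eventually.of_forall fun x => ?_)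
  rw [Real.norm_eq_abs, abs_of_nonneg (h.hc.le.trans (h.hb x).1)]
  exact (h.hb x).2

lemma R_ge (h : SF T r c C Φ) (ν : Measure X) [IsProbabilityMeasure ν] : c ≤ ∫ x, r x ∂ν := by
  have := integral_mono (integrable_const c) (h.r_int ν) fun x => (h.hb x).1
  simpa using this

lemma R_le (h : SF T r c C Φ) (ν : Measure X) [IsProbabilityMeasure ν] : ∫ x, r x ∂ν ≤ C := by
  have := integral_mono (h.r_int ν) (integrable_const C) fun x => (h.hb x).2
  simpa using this

lemma R_pos (h : SF T r c C Φ) (ν : Measure X) [IsProbabilityMeasure ν] : 0 < ∫ x, r x ∂ν :=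
  h.hc.trans_le (h.R_ge ν)

lemma lint_r (h : SF T r c C Φ) (ν : Measure X) [IsProbabilityMeasure ν] :
    ∫⁻ x, ENNReal.ofReal (r x) ∂ν = ENNReal.ofReal (∫ x, r x ∂ν) :=
  (ofReal_integral_eq_lintegral_ofReal (h.r_int ν)
    (Eventually.of_forall fun x => h.hc.le.trans (h.hb x).1)).symm

lemma susp_def (ν : Measure X) :
    suspensionMeasure ν r = (ENNReal.ofReal (∫ x, r x ∂ν))⁻¹ • sus ν r := rfl

lemma susp_prob (h : SF T r c C Φ) (ν : Measure X) [IsProbabilityMeasure ν] :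
    IsProbabilityMeasure (suspensionMeasure ν r) := by
  constructor
  have := sus_base h.hr ν (S := univ) MeasurableSet.univ
  simp only [mem_univ, setOf_true, Measure.restrict_univ] at this
  rw [susp_def, Measure.smul_apply, smul_eq_mul, this, h.lint_r]
  exact ENNReal.inv_mul_cancel (by simpa using h.R_pos ν) ENNReal.ofReal_ne_top

lemma susp_inv (h : SF T r c C Φ) {ν : Measure X} [IsProbabilityMeasure ν]
    (hν : MeasurePreserving T ν ν) : FlowInvariant Φ (suspensionMeasure ν r) := fun t => by
  rw [susp_def]
  exact (h.sus_inv hν t).smul_measure _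

lemma susp_base (h : SF T r c C Φ) (ν : Measure X) [IsProbabilityMeasure ν] {S : Set X}
    (hS : MeasurableSet S) : suspensionMeasure ν r {q | q.val.1 ∈ S} =
      (ENNReal.ofReal (∫ x, r x ∂ν))⁻¹ * ∫⁻ x in S, ENNReal.ofReal (r x) ∂ν := by
  rw [susp_def, Measure.smul_apply, smul_eq_mul, sus_base h.hr ν hS]

lemma base_le (h : SF T r c C Φ) (ν : Measure X) [IsProbabilityMeasure ν] {S : Set X}
    (hS : MeasurableSet S) : suspensionMeasure ν r {q | q.val.1 ∈ S} ≤
      ENNReal.ofReal (C / c) * ν S := by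
  rw [h.susp_base ν hS]
  have h1 : ∫⁻ x in S, ENNReal.ofReal (r x) ∂ν ≤ ENNReal.ofReal C * ν S := by
    refine (lintegral_mono fun x => ENNReal.ofReal_le_ofReal (h.hb x).2).trans ?_
    simp
  have h2 : (ENNReal.ofReal (∫ x, r x ∂ν))⁻¹ ≤ ENNReal.ofReal (c⁻¹) := by
    rw [← ENNReal.ofReal_inv_of_pos (h.R_pos ν)]
    exact ENNReal.ofReal_le_ofReal (inv_anti₀ h.hc (h.R_ge ν))
  refine (mul_le_mul' h2 h1).trans ?_
  rw [← mul_assoc, ← ENNReal.ofReal_mul (inv_nonneg.2 h.hc.le), div_eq_inv_mul]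

lemma le_base (h : SF T r c C Φ) (ν : Measure X) [IsProbabilityMeasure ν] {S : Set X}
    (hS : MeasurableSet S) : ENNReal.ofReal (c / C) * ν S ≤
      suspensionMeasure ν r {q | q.val.1 ∈ S} := by
  rw [h.susp_base ν hS]
  have h1 : ENNReal.ofReal c * ν S ≤ ∫⁻ x in S, ENNReal.ofReal (r x) ∂ν := by
    refine le_trans ?_ (lintegral_mono fun x => ENNReal.ofReal_le_ofReal (h.hb x).1)
    simp
  have h2 : ENNReal.ofReal (C⁻¹) ≤ (ENNReal.ofReal (∫ x, r x ∂ν))⁻¹ := by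
    rw [← ENNReal.ofReal_inv_of_pos (h.R_pos ν)]
    exact ENNReal.ofReal_le_ofReal (inv_anti₀ (h.R_pos ν) (h.R_le ν))
  refine le_trans ?_ (mul_le_mul' h2 h1)
  have hC : 0 < C := h.R_pos ν |>.trans_le (h.R_le ν)
  rw [← mul_assoc, ← ENNReal.ofReal_mul (inv_nonneg.2 hC.le), div_eq_inv_mul]

lemma base_zero_iff (h : SF T r c C Φ) (ν : Measure X) [IsProbabilityMeasure ν] {S : Set X}
    (hS : MeasurableSet S) : suspensionMeasure ν r {q | q.val.1 ∈ S} = 0 ↔ ν S = 0 := by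
  constructor
  · intro h0
    have := h.le_base ν hS
    rw [h0, nonpos_iff_eq_zero, mul_eq_zero] at this
    refine this.resolve_left ?_
    have hC : 0 < C := h.R_pos ν |>.trans_le (h.R_le ν)
    have : 0 < c / C := div_pos h.hc hC
    simpa using this
  · intro h0
    have := h.base_le ν hS
    rwa [h0, mul_zero, nonpos_iff_eq_zero] at this

lemma shift_inv_iter {S : Set X} (hS : T ⁻¹' S = S) (n : ℕ) (x : X) : T^[n] x ∈ S ↔ x ∈ S := by
  induction n generalizing x with
  | zero => rfl
  | succ n ih =>
    rw [Function.iterate_succ_apply, ih]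
    conv_rhs => rw [← hS]
    rfl

/-- Ergodicity passes to the suspension. -/
lemma susp_erg (h : SF T r c C Φ) {ν : Measure X} [IsProbabilityMeasure ν] (hν : Ergodic T ν) :
    FlowErgodic Φ (suspensionMeasure ν r) := by
  have := h.susp_prob ν
  refine ⟨h.susp_inv hν.toMeasurePreserving, fun s hs hinv => ?_⟩
  let sec : X → Susp r := fun x => ⟨(x, 0), le_rfl, h.hc.trans_le (h.hb x).1⟩
  have hsec : Measurable sec := (measurable_id.prodMk measurable_const).subtype_mk
  let s0 : Set X := sec ⁻¹' s
  have hs0 : MeasurableSet s0 := hsec hs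
  have hmem : ∀ t q, Φ t q ∈ s ↔ q ∈ s := fun t q => by
    conv_rhs => rw [← hinv t]
    rfl
  have hfib : ∀ q, q ∈ s ↔ q.val.1 ∈ s0 := by
    intro q
    have : Φ q.val.2 (sec q.val.1) = q := by
      apply Subtype.ext
      rw [h.fib _ _ (by simpa [sec] using q.2.1) (by simpa [sec] using q.2.2)]
      simp [sec]
    conv_lhs => rw [← this, hmem]
    rfl
  have hT : T ⁻¹' s0 = s0 := by
    ext x
    show sec (T x) ∈ s ↔ sec x ∈ s
    have hx := h.hb x
    have hcp := h.hc
    let q1 : Susp r := ⟨(x, r x - c), by simp only; linarith, by simp only; linarith⟩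
    have e2 : Φ c q1 = sec (T x) := by
      apply Subtype.ext
      rw [h.up1 hcp.le le_rfl q1 (by simp [q1])]
      simp [q1, sec]
    rw [← e2, hmem, hfib, hfib]
  have hs' : s = {q | q.val.1 ∈ s0} := by ext q; exact hfib q
  rcases hν.toPreErgodic.prob_eq_zero_or_one hs0 hT with h0 | h1
  · left
    rw [hs', h.base_zero_iff ν hs0, h0]
  · right
    have h2 : ν s0ᶜ = 0 := (prob_compl_eq_zero_iff hs0).2 h1
    have h3 := (h.base_zero_iff ν hs0.compl).2 h2
    have h4 : {q : Susp r | q.val.1 ∈ s0ᶜ} = sᶜ := by rw [hs']; rfl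
    rw [h4] at h3
    exact (prob_compl_eq_zero_iff hs).1 h3

lemma base_erg (h : SF T r c C Φ) {ν : Measure X} [IsProbabilityMeasure ν]
    (hν : MeasurePreserving T ν ν) (he : FlowErgodic Φ (suspensionMeasure ν r)) :
    Ergodic T ν := by
  have := h.susp_prob ν
  refine { hν with aeconst_set := ?_ }
  intro S hS hT
  have hm : MeasurableSet {q : Susp r | q.val.1 ∈ S} :=
    (measurable_fst.comp measurable_subtype_coe) hS
  have hpos : ∀ t, 0 ≤ t → ∀ q, (Φ t q).val.1 ∈ S ↔ q.val.1 ∈ S := by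
    intro t ht q
    obtain ⟨n, -, -, h3, -⟩ := h.hchar t ht q
    rw [h3]
    exact shift_inv_iter hT n _
  have hinv : ∀ t, Φ t ⁻¹' {q : Susp r | q.val.1 ∈ S} = {q : Susp r | q.val.1 ∈ S} := by
    intro t
    ext q
    show (Φ t q).val.1 ∈ S ↔ q.val.1 ∈ S
    rcases le_total 0 t with ht | ht
    · exact hpos t ht q
    · have := hpos (-t) (by linarith) (Φ t q)
      rw [h.neg_cancel] at this
      exact this.symm
  rw [eventuallyConst_set']
  rcases he.2 _ hm hinv with h0 | h1
  · left
    exact ae_eq_empty.2 ((h.base_zero_iff ν hS).1 h0)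
  · right
    rw [ae_eq_univ]
    rw [← h.base_zero_iff ν hS.compl]
    exact (prob_compl_eq_zero_iff hm).2 h1

end SF

end flow

end Abr

set_option linter.unusedSectionVars false
set_option linter.unusedVariables false

namespace Abr
open Filter Topology

section flow
variable {X : Type*} [MeasurableSpace X]
variable {T : X ≃ᵐ X} {r : X → ℝ} {c C : ℝ} {Φ : ℝ → Susp r → Susp r}

/-- The (unnormalized) base measure of a measure on the suspension. -/
noncomputable def bas (μ : Measure (Susp r)) : Measure X :=
  (μ.withDensity (fun q => (ENNReal.ofReal (r q.val.1))⁻¹)).map (fun q => q.val.1)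

namespace SF

lemma mx : Measurable fun q : Susp r => q.val.1 := measurable_fst.comp measurable_subtype_coe

lemma bas_lintegral (h : SF T r c C Φ) (μ : Measure (Susp r)) {F : X → ℝ≥0∞} (hF : Measurable F) :
    ∫⁻ x, F x ∂(bas μ) = ∫⁻ q, (ENNReal.ofReal (r q.val.1))⁻¹ * F q.val.1 ∂μ := by
  unfold bas
  have hd : Measurable fun q : Susp r => (ENNReal.ofReal (r q.val.1))⁻¹ :=
    ((h.hr.comp mx).ennreal_ofReal).inv
  have hFx : Measurable fun q : Susp r => F q.val.1 := hF.comp mx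
  rw [lintegral_map hF mx, lintegral_withDensity_eq_lintegral_mul _ hd hFx]
  rfl

lemma ambrose_key (h : SF T r c C Φ) {μ : Measure (Susp r)} [IsProbabilityMeasure μ]
    (hμ : FlowInvariant Φ μ) {f : X × ℝ → ℝ≥0∞} (hf : Measurable f) :
    ∫⁻ q, f q.val ∂μ = ∫⁻ q, (ENNReal.ofReal (r q.val.1))⁻¹ *
      (∫⁻ u in Ico 0 (r q.val.1), f (q.val.1, u)) ∂μ := by
  have hR := region_meas h.hr
  set R := {p : X × ℝ | 0 ≤ p.2 ∧ p.2 < r p.1} with hRdef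
  let w : X → ℝ≥0∞ := fun x => (ENNReal.ofReal (r x))⁻¹
  have hw : Measurable w := h.hr.ennreal_ofReal.inv
  let k : X × ℝ → ℝ≥0∞ := fun p => w p.1 * R.indicator f p
  have hk : Measurable k := (hw.comp measurable_fst).mul (hf.indicator hR)
  let g : Susp r × ℝ → X × ℝ := fun z => (z.1.val.1, z.1.val.2 + z.2)
  have hms : Measurable fun z : Susp r × ℝ => z.1.val.2 :=
    measurable_snd.comp (measurable_subtype_coe.comp measurable_fst)
  have hg : Measurable g := (mx.comp measurable_fst).prodMk (hms.add measurable_snd)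
  let B : Set (Susp r × ℝ) := {z | 0 ≤ z.1.val.2 - z.2 ∧ z.1.val.2 - z.2 < r z.1.val.1}
  have hB : MeasurableSet B :=
    (measurableSet_le measurable_const (hms.sub measurable_snd)).inter
      (measurableSet_lt (hms.sub measurable_snd) (h.hr.comp (mx.comp measurable_fst)))
  let l : Susp r × ℝ → ℝ≥0∞ := B.indicator fun z => w z.1.val.1 * f z.1.val
  have hl : Measurable l := by
    refine Measurable.indicator ?_ hB
    exact (hw.comp (mx.comp measurable_fst)).mul
      (hf.comp (measurable_subtype_coe.comp measurable_fst))
  have e1 : ∀ q : Susp r, (ENNReal.ofReal (r q.val.1))⁻¹ *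
      (∫⁻ u in Ico 0 (r q.val.1), f (q.val.1, u)) = ∫⁻ t, k (g (q, t)) := by
    intro q
    have hi : Measurable fun u : ℝ => R.indicator f (q.val.1, u) :=
      (hf.indicator hR).comp measurable_prodMk_left
    have a1 : ∫⁻ u in Ico 0 (r q.val.1), f (q.val.1, u) = ∫⁻ u, R.indicator f (q.val.1, u) := by
      rw [← lintegral_indicator measurableSet_Ico]; rfl
    have a2 := lintegral_add_left_eq_self (μ := (volume : Measure ℝ))
      (fun u : ℝ => R.indicator f (q.val.1, u)) q.val.2
    rw [a1, ← a2, ← lintegral_const_mul]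
    exact hi.comp (measurable_const_add _)
  have e2 : ∀ t : ℝ, ∀ q : Susp r, k (g (Φ (-t) q, t)) = l (q, t) := by
    intro t q
    by_cases hq : (q, t) ∈ B
    · have hq' : 0 ≤ q.val.2 - t ∧ q.val.2 - t < r q.val.1 := hq
      have e : (Φ (-t) q).val = (q.val.1, q.val.2 + -t) :=
        h.fib (-t) q (by linarith [hq'.1]) (by linarith [hq'.2])
      have eg : g (Φ (-t) q, t) = q.val := by
        simp only [g, e]; ext <;> simp
      rw [eg]
      simp only [l, k]
      rw [indicator_of_mem hq, indicator_of_mem (show q.val ∈ R from q.2)]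
    · simp only [l]
      rw [indicator_of_notMem hq]
      by_cases hq2 : g (Φ (-t) q, t) ∈ R
      · exfalso
        apply hq
        have hq3 : 0 ≤ (Φ (-t) q).val.2 + t ∧ (Φ (-t) q).val.2 + t < r (Φ (-t) q).val.1 := hq2
        have e := h.fib t (Φ (-t) q) hq3.1 hq3.2
        rw [h.cancel_neg] at e
        show 0 ≤ q.val.2 - t ∧ q.val.2 - t < r q.val.1
        have p2 := (Φ (-t) q).2
        have e1 := congrArg Prod.fst e
        have e2 := congrArg Prod.snd e
        simp only at e1 e2
        rw [e1, e2]
        constructor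
        · linarith [p2.1]
        · linarith [p2.2]
      · simp only [k]
        rw [indicator_of_notMem hq2, mul_zero]
  simp_rw [e1]
  rw [lintegral_lintegral_swap (f := fun q t => k (g (q, t))) (hk.comp hg).aemeasurable]
  have e3 : ∀ t : ℝ, ∫⁻ q, k (g (q, t)) ∂μ = ∫⁻ q, l (q, t) ∂μ := by
    intro t
    have hkt : Measurable fun q : Susp r => k (g (q, t)) :=
      (hk.comp hg).comp measurable_prodMk_right
    rw [← (hμ (-t)).lintegral_comp hkt]
    refine lintegral_congr fun q => ?_
    exact e2 t q
  simp_rw [e3]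
  rw [← lintegral_lintegral_swap (f := fun q t => l (q, t)) hl.aemeasurable]
  refine lintegral_congr fun q => ?_
  have e4 : ∀ t, l (q, t) = (Ioc (q.val.2 - r q.val.1) q.val.2).indicator
      (fun _ => w q.val.1 * f q.val) t := by
    intro t
    simp only [l]
    by_cases ht : t ∈ Ioc (q.val.2 - r q.val.1) q.val.2
    · rw [indicator_of_mem ht, indicator_of_mem]
      exact ⟨by simp only; linarith [ht.2], by simp only; linarith [ht.1]⟩
    · rw [indicator_of_notMem ht, indicator_of_notMem]
      rintro ⟨h1, h2⟩
      simp only at h1 h2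
      exact ht ⟨by linarith, by linarith⟩
  simp_rw [e4]
  rw [lintegral_indicator_const measurableSet_Ioc, Real.volume_Ioc, sub_sub_cancel]
  simp only [w]
  have hrp : 0 < r q.val.1 := h.hc.trans_le (h.hb _).1
  rw [mul_comm (ENNReal.ofReal _)⁻¹, mul_assoc, ENNReal.inv_mul_cancel (by simpa using hrp)
    ENNReal.ofReal_ne_top, mul_one]

lemma bas_finite (h : SF T r c C Φ) (μ : Measure (Susp r)) [IsProbabilityMeasure μ] :
    IsFiniteMeasure (bas μ) := by
  constructor
  have := h.bas_lintegral μ (F := fun _ => 1) measurable_const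
  simp only [lintegral_const, one_mul, mul_one] at this
  rw [this]
  calc _ ≤ ∫⁻ q, (ENNReal.ofReal c)⁻¹ ∂μ := by
        refine lintegral_mono fun q => ?_
        exact ENNReal.inv_le_inv.2 (ENNReal.ofReal_le_ofReal (h.hb _).1)
    _ < ⊤ := by
        simp only [lintegral_const, measure_univ, mul_one]
        rw [ENNReal.inv_lt_top]
        simpa using h.hc

lemma sus_bas (h : SF T r c C Φ) {μ : Measure (Susp r)} [IsProbabilityMeasure μ]
    (hμ : FlowInvariant Φ μ) : sus (bas μ) r = μ := by
  have := h.bas_finite μ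
  ext E0 hE0
  obtain ⟨E, hE, rfl⟩ := hE0
  have hi : Measurable (E.indicator (1 : X × ℝ → ℝ≥0∞)) := measurable_one.indicator hE
  have hR := region_meas h.hr
  rw [sus_apply h.hr _ hE, h.bas_lintegral, ← h.ambrose_key hμ hi]
  · rw [← lintegral_indicator_one (measurable_subtype_coe hE)]
    rfl
  · have : (fun x => ∫⁻ u in Ico 0 (r x), E.indicator (1 : X × ℝ → ℝ≥0∞) (x, u)) =
        fun x => ∫⁻ u, ({p : X × ℝ | 0 ≤ p.2 ∧ p.2 < r p.1}.indicator
          (E.indicator (1 : X × ℝ → ℝ≥0∞))) (x, u) := by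
      funext x
      rw [← lintegral_indicator measurableSet_Ico]
      rfl
    rw [this]
    exact (hi.indicator hR).lintegral_prod_right'

lemma bas_inv (h : SF T r c C Φ) {μ : Measure (Susp r)} [IsProbabilityMeasure μ]
    (hμ : FlowInvariant Φ μ) : MeasurePreserving T (bas μ) (bas μ) := by
  have hfin := h.bas_finite μ
  refine ⟨T.measurable, ?_⟩
  ext A hA
  rw [Measure.map_apply T.measurable hA]
  have hcp := h.hc
  have hc0 : ENNReal.ofReal c ≠ 0 := by simpa using hcp
  -- general computation of strips
  have strip : ∀ (S : Set X), MeasurableSet S → ∀ (a : X → ℝ), Measurable a →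
      (∀ x, 0 ≤ a x ∧ a x + c ≤ r x) →
      μ (Subtype.val ⁻¹' {p : X × ℝ | p.1 ∈ S ∧ a p.1 ≤ p.2 ∧ p.2 < a p.1 + c}) =
        ENNReal.ofReal c * bas μ S := by
    intro S hS a ha hab
    have hE : MeasurableSet {p : X × ℝ | p.1 ∈ S ∧ a p.1 ≤ p.2 ∧ p.2 < a p.1 + c} :=
      (measurable_fst hS).inter
        ((measurableSet_le (ha.comp measurable_fst) measurable_snd).inter
          (measurableSet_lt measurable_snd ((ha.comp measurable_fst).add_const c)))
    conv_lhs => rw [← h.sus_bas hμ]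
    rw [sus_apply h.hr _ hE, ← lintegral_indicator_const hS]
    refine lintegral_congr fun x => ?_
    obtain ⟨a0, a1⟩ := hab x
    by_cases hx : x ∈ S
    · rw [indicator_of_mem hx]
      have : ∀ u, ({p : X × ℝ | p.1 ∈ S ∧ a p.1 ≤ p.2 ∧ p.2 < a p.1 + c}.indicator 1 (x, u) : ℝ≥0∞)
          = (Ico (a x) (a x + c)).indicator 1 u := by
        intro u
        apply ind_congr
        show (x ∈ S ∧ a x ≤ u ∧ u < a x + c) ↔ (a x ≤ u ∧ u < a x + c)
        simp [hx]
      simp_rw [this]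
      rw [lintegral_indicator_one measurableSet_Ico, Measure.restrict_apply measurableSet_Ico,
        Ico_inter_Ico, Real.volume_Ico]
      congr 1
      rw [sup_of_le_left a0, inf_of_le_left a1]
      ring
    · rw [indicator_of_notMem hx]
      have : ∀ u, ({p : X × ℝ | p.1 ∈ S ∧ a p.1 ≤ p.2 ∧ p.2 < a p.1 + c}.indicator 1 (x, u) : ℝ≥0∞)
          = 0 := by
        intro u
        apply indicator_of_notMem
        exact fun hh => hx hh.1
      simp [this]
  have s1 := strip A hA (fun _ => 0) measurable_const fun x => ⟨le_rfl, by linarith [(h.hb x).1]⟩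
  have s2 := strip (T ⁻¹' A) (T.measurable hA) (fun x => r x - c) (h.hr.sub_const c)
    fun x => ⟨by linarith [(h.hb x).1], by linarith⟩
  have hm : MeasurableSet (Subtype.val ⁻¹' {p : X × ℝ | p.1 ∈ A ∧ 0 ≤ p.2 ∧ p.2 < 0 + c} :
      Set (Susp r)) := by
    apply measurable_subtype_coe
    exact (measurable_fst hA).inter
        ((measurableSet_le measurable_const measurable_snd).inter
          (measurableSet_lt measurable_snd measurable_const))
  have s3 := (hμ c).measure_preimage hm.nullMeasurableSet
  have s4 : Φ c ⁻¹' (Subtype.val ⁻¹' {p : X × ℝ | p.1 ∈ A ∧ 0 ≤ p.2 ∧ p.2 < 0 + c}) =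
      Subtype.val ⁻¹' {p : X × ℝ | p.1 ∈ T ⁻¹' A ∧ r p.1 - c ≤ p.2 ∧ p.2 < r p.1 - c + c} := by
    ext q
    show ((Φ c q).val.1 ∈ A ∧ 0 ≤ (Φ c q).val.2 ∧ (Φ c q).val.2 < 0 + c) ↔
      (T q.val.1 ∈ A ∧ r q.val.1 - c ≤ q.val.2 ∧ q.val.2 < r q.val.1 - c + c)
    have q1 := q.2.1
    have q2 := q.2.2
    by_cases hq : q.val.2 + c < r q.val.1
    · rw [h.up0 hcp.le q hq]
      constructor
      · rintro ⟨_, _, h3⟩; simp only at h3; linarith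
      · rintro ⟨_, h2, _⟩; linarith
    · rw [h.up1 hcp.le le_rfl q (not_lt.1 hq)]
      simp only
      constructor
      · rintro ⟨h1, _, h3⟩; exact ⟨h1, by linarith, by linarith⟩
      · rintro ⟨h1, _, h3⟩; exact ⟨h1, by linarith, by linarith⟩
  rw [s4, s2, s1] at s3
  exact (ENNReal.mul_right_inj hc0 ENNReal.ofReal_ne_top).1 s3

/-- Every flow-invariant probability measure is a suspension. -/
lemma ambrose (h : SF T r c C Φ) {μ : Measure (Susp r)} [hp : IsProbabilityMeasure μ]
    (hμ : FlowInvariant Φ μ) : ∃ ν : Measure X, IsProbabilityMeasure ν ∧ MeasurePreserving T ν ν ∧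
      μ = suspensionMeasure ν r := by
  have hfin := h.bas_finite μ
  have hs := h.sus_bas hμ
  have hne : bas μ ≠ 0 := by
    intro h0
    rw [h0] at hs
    have : sus (0 : Measure X) r = 0 := by simp [sus]
    rw [this] at hs
    exact IsProbabilityMeasure.ne_zero μ hs.symm
  have hN : bas μ univ ≠ 0 := fun h0 => hne (Measure.measure_univ_eq_zero.1 h0)
  let ν : Measure X := (bas μ univ)⁻¹ • bas μ
  have hνp : IsProbabilityMeasure ν := ⟨by
    simp only [ν, Measure.smul_apply, smul_eq_mul]
    exact ENNReal.inv_mul_cancel hN (measure_ne_top _ _)⟩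
  have hνi : MeasurePreserving T ν ν := (h.bas_inv hμ).smul_measure _
  refine ⟨ν, hνp, hνi, ?_⟩
  have hsν : sus ν r = (bas μ univ)⁻¹ • μ := by
    ext E0 hE0
    obtain ⟨E, hE, rfl⟩ := hE0
    have hEμ : μ (Subtype.val ⁻¹' E) = sus (bas μ) r (Subtype.val ⁻¹' E) := by rw [hs]
    rw [sus_apply h.hr _ hE, Measure.smul_apply, hEμ, sus_apply h.hr _ hE, lintegral_smul_measure]
  have hpν := h.susp_prob ν
  rw [susp_def, hsν, smul_smul] at hpν ⊢
  have := hpν.measure_univ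
  rw [Measure.smul_apply, hp.measure_univ, smul_eq_mul, mul_one] at this
  rw [this, one_smul]

lemma susp_integral (h : SF T r c C Φ) (ν : Measure X) [IsProbabilityMeasure ν] {g : X × ℝ → ℝ}
    (hg : Measurable g) {K : ℝ} (hK : ∀ p, |g p| ≤ K) :
    Integrable (fun x => ∫ s in (0 : ℝ)..(r x), g (x, s)) ν ∧
    ∫ q, g q.val ∂(suspensionMeasure ν r) =
      (∫ x, r x ∂ν)⁻¹ * ∫ x, (∫ s in (0 : ℝ)..(r x), g (x, s)) ∂ν := by
  have hR := region_meas h.hr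
  set R := {p : X × ℝ | 0 ≤ p.2 ∧ p.2 < r p.1} with hRdef
  have hIntg : Integrable (R.indicator g) (ν.prod volume) := by
    rw [integrable_indicator_iff hR]
    refine Measure.integrableOn_of_bounded (M := K) ?_ hg.aestronglyMeasurable
      (Eventually.of_forall fun p => hK p)
    rw [Measure.prod_apply hR]
    have : ∀ x, (volume : Measure ℝ) (Prod.mk x ⁻¹' R) ≤ ENNReal.ofReal C := fun x => by
      have : Prod.mk x ⁻¹' R = Ico 0 (r x) := rfl
      rw [this, Real.volume_Ico, sub_zero]
      exact ENNReal.ofReal_le_ofReal (h.hb x).2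
    refine ((lintegral_mono this).trans_lt ?_).ne
    simp
  have e1 : ∀ x, ∫ s in (0 : ℝ)..(r x), g (x, s) = ∫ s, R.indicator g (x, s) := by
    intro x
    rw [intervalIntegral.integral_of_le (h.hc.le.trans (h.hb x).1),
      ← integral_Ico_eq_integral_Ioc, ← integral_indicator measurableSet_Ico]
    rfl
  simp_rw [e1]
  refine ⟨hIntg.integral_prod_left, ?_⟩
  rw [susp_def, integral_smul_measure, ← integral_prod _ hIntg, integral_indicator hR]
  have e2 : ∫ q, g q.val ∂(sus ν r) = ∫ p in R, g p ∂(ν.prod volume) :=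
    integral_subtype_comap hR g
  rw [e2, ENNReal.toReal_inv, ENNReal.toReal_ofReal (h.R_pos ν).le, smul_eq_mul]

end SF

end flow

end Abr

set_option linter.unusedSectionVars false
set_option linter.unusedVariables false

namespace Abr
open Filter Topology

section circ
variable {τ : ℝ} [hτ : Fact (0 < τ)]

/-- Representative in `[0, τ)` of a point of the circle. -/
noncomputable def rep (w : AddCircle τ) : ℝ := (AddCircle.equivIco τ 0 w : ℝ)

lemma rep_meas : Measurable (rep : AddCircle τ → ℝ) :=
  measurable_subtype_coe.comp (AddCircle.measurableEquivIco τ 0).measurable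

lemma rep_nonneg (w : AddCircle τ) : 0 ≤ rep w := (AddCircle.equivIco τ 0 w).2.1

lemma rep_lt (w : AddCircle τ) : rep w < τ := by
  have := (AddCircle.equivIco τ 0 w).2.2
  unfold rep
  linarith

lemma rep_coe {s : ℝ} (hs : 0 ≤ s) :
    rep (s : AddCircle τ) = s - (⌊s / τ⌋₊ : ℕ) * τ := by
  have hp := hτ.out
  have h1 := Nat.floor_le (div_nonneg hs hp.le)
  have h2 := Nat.lt_floor_add_one (s / τ)
  rw [le_div_iff₀ hp] at h1
  rw [div_lt_iff₀ hp] at h2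
  have hm : s - (⌊s / τ⌋₊ : ℕ) * τ ∈ Ico 0 (0 + τ) := ⟨by linarith, by linarith⟩
  have e : (s : AddCircle τ) = ((s - (⌊s / τ⌋₊ : ℕ) * τ : ℝ) : AddCircle τ) := by
    rw [AddCircle.coe_sub, ← nsmul_eq_mul, AddCircle.coe_nsmul, AddCircle.coe_period, nsmul_zero,
      sub_zero]
  unfold rep
  rw [e, AddCircle.equivIco_coe_eq hm]

end circ

section flow
variable {X : Type*} [MeasurableSpace X]
variable {T : X ≃ᵐ X} {r : X → ℝ} {c C : ℝ} {Φ : ℝ → Susp r → Susp r}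

namespace SF
variable {τ : ℝ} [hτ : Fact (0 < τ)]

/-- Projection to the circle extension. -/
def Dm (τ : ℝ) (r : X → ℝ) : Susp r → X × AddCircle τ := fun q => (q.val.1, (q.val.2 : AddCircle τ))
/-- Level. -/
noncomputable def jm (τ : ℝ) (r : X → ℝ) : Susp r → ℕ := fun q => ⌊q.val.2 / τ⌋₊
/-- Return count. -/
noncomputable def nm (τ : ℝ) [Fact (0 < τ)] (r : X → ℝ) : X × AddCircle τ → ℕ :=
  fun z => ⌈(r z.1 - rep z.2) / τ⌉₊ - 1

lemma jm_zero (q : Susp r) : jm τ r q = 0 ↔ q.val.2 < τ := by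
  unfold jm
  rw [Nat.floor_eq_zero, div_lt_one hτ.out]

lemma ret_iff (h : SF T r c C Φ) (hτc : τ ≤ c) (q : Susp r) :
    jm τ r (Φ τ q) = 0 ↔ r q.val.1 ≤ q.val.2 + τ := by
  have hp := hτ.out
  rw [jm_zero]
  by_cases hq : q.val.2 + τ < r q.val.1
  · rw [h.up0 hp.le q hq]
    have := q.2.1
    constructor
    · intro h1; simp only at h1; linarith
    · intro h1; linarith
  · rw [h.up1 hp.le hτc q (not_lt.1 hq)]
    have := q.2.2
    constructor
    · intro _; exact not_lt.1 hq
    · intro _; simp only; linarith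

lemma tower (h : SF T r c C Φ) (hτc : τ ≤ c) (ν : Measure X) [IsProbabilityMeasure ν]
    (hν : MeasurePreserving T ν ν) :
    Tower (suspensionMeasure ν r) (Φ τ) (ν.prod (AddCircle.haarAddCircle (T := τ)))
      (skw T fun x => -(r x : AddCircle τ)) (ENNReal.ofReal (τ / ∫ x, r x ∂ν))
      (Dm τ r) (jm τ r) (nm τ r) (⌈C / τ⌉₊ + 1) := by
  have hp := hτ.out
  have hmk : Measurable (fun s : ℝ => (s : AddCircle τ)) := AddCircle.measurable_mk'
  have hsm : Measurable fun q : Susp r => q.val.2 := measurable_snd.comp measurable_subtype_coe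
  have hDm : Measurable (Dm τ r) := mx.prodMk (hmk.comp hsm)
  have hjm : Measurable (jm τ r) := Nat.measurable_floor.comp (hsm.div_const τ)
  have hst : {y : Susp r | jm τ r (Φ τ y) = 0} =
      Subtype.val ⁻¹' {p : X × ℝ | r p.1 ≤ p.2 + τ} := by
    ext q; exact h.ret_iff hτc q
  refine ⟨h.susp_inv hν τ, skw_mp hν ?_, hDm, hjm, ?_, ?_, ?_, ?_, ?_, ?_, ?_⟩
  · exact (hmk.comp h.hr).neg
  · have : Measurable fun z : X × AddCircle τ => (r z.1 - rep z.2) / τ :=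
      ((h.hr.comp measurable_fst).sub (rep_meas.comp measurable_snd)).div_const τ
    exact (measurable_from_top (f := fun k : ℕ => k - 1)).comp (Nat.measurable_ceil.comp this)
  · intro y
    have : jm τ r y ≤ ⌈C / τ⌉₊ := by
      unfold jm
      refine (Nat.floor_le_floor ?_).trans (Nat.floor_le_ceil _)
      exact div_le_div_of_nonneg_right (y.2.2.le.trans (h.hb _).2) hp.le
    omega
  · intro z
    have : nm τ r z ≤ ⌈C / τ⌉₊ := by
      unfold nm
      refine (Nat.sub_le _ _).trans (Nat.ceil_mono ?_)
      exact div_le_div_of_nonneg_right (by linarith [(h.hb z.1).2, rep_nonneg z.2]) hp.le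
    omega
  · rw [hst]
    ext E hE
    have hm1 : MeasurableSet {p : X × ℝ | r p.1 ≤ p.2 + τ} :=
      measurableSet_le (h.hr.comp measurable_fst) (measurable_snd.add_const τ)
    have hd' : Measurable fun p : X × ℝ => (p.1, (p.2 : AddCircle τ)) :=
      measurable_fst.prodMk (hmk.comp measurable_snd)
    have hm2 : MeasurableSet {p : X × ℝ | (p.1, (p.2 : AddCircle τ)) ∈ E ∧ r p.1 ≤ p.2 + τ} :=
      (hd' hE).inter hm1
    rw [Measure.map_apply hDm hE, Measure.restrict_apply (hDm hE), susp_def, Measure.smul_apply]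
    have e0 : Dm τ r ⁻¹' E ∩ Subtype.val ⁻¹' {p : X × ℝ | r p.1 ≤ p.2 + τ} =
      Subtype.val ⁻¹' {p : X × ℝ | (p.1, (p.2 : AddCircle τ)) ∈ E ∧ r p.1 ≤ p.2 + τ} := rfl
    rw [e0, sus_apply h.hr _ hm2]
    have e1 : ∀ x, ∫⁻ u in Ico 0 (r x), {p : X × ℝ | (p.1, (p.2 : AddCircle τ)) ∈ E ∧
        r p.1 ≤ p.2 + τ}.indicator (1 : X × ℝ → ℝ≥0∞) (x, u) =
        ENNReal.ofReal τ * AddCircle.haarAddCircle (T := τ) (Prod.mk x ⁻¹' E) := by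
      intro x
      have a0 : ∀ u : ℝ, {p : X × ℝ | (p.1, (p.2 : AddCircle τ)) ∈ E ∧
          r p.1 ≤ p.2 + τ}.indicator (1 : X × ℝ → ℝ≥0∞) (x, u) =
          (Ici (r x - τ)).indicator
            (fun u : ℝ => (Prod.mk x ⁻¹' E).indicator (1 : AddCircle τ → ℝ≥0∞) (u : AddCircle τ)) u := by
        intro u
        by_cases hu : u ∈ Ici (r x - τ)
        · rw [indicator_of_mem hu]
          apply ind_congr
          have : r x ≤ u + τ := by linarith [mem_Ici.1 hu]
          show (x, (u : AddCircle τ)) ∈ E ∧ r x ≤ u + τ ↔ (x, (u : AddCircle τ)) ∈ E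
          simp [this]
        · rw [indicator_of_notMem hu, indicator_of_notMem]
          rintro ⟨_, h2⟩
          apply hu
          simp only at h2
          exact mem_Ici.2 (by linarith)
      simp_rw [a0]
      rw [lintegral_indicator measurableSet_Ici, Measure.restrict_restrict measurableSet_Ici]
      have a1 : Ici (r x - τ) ∩ Ico 0 (r x) = Ico (r x - τ) (r x) := by
        ext u
        simp only [mem_inter_iff, mem_Ici, mem_Ico]
        constructor
        · rintro ⟨a, b, d⟩; exact ⟨a, d⟩
        · rintro ⟨a, d⟩; exact ⟨a, by linarith [(h.hb x).1], d⟩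
      rw [a1, Measure.restrict_congr_set (Ico_ae_eq_Ioc (μ := volume))]
      have a2 := AddCircle.lintegral_preimage τ (r x - τ)
        ((Prod.mk x ⁻¹' E).indicator (1 : AddCircle τ → ℝ≥0∞))
      rw [sub_add_cancel] at a2
      rw [a2, lintegral_indicator_one (measurable_prodMk_left hE),
        AddCircle.volume_eq_smul_haarAddCircle]
      rfl
    simp_rw [e1]
    rw [lintegral_const_mul _ (measurable_measure_prodMk_left hE), Measure.smul_apply,
      Measure.prod_apply hE, smul_eq_mul, smul_eq_mul, ← mul_assoc]
    congr 1
    rw [div_eq_mul_inv, ENNReal.ofReal_mul hp.le, ENNReal.ofReal_inv_of_pos (h.R_pos ν), mul_comm]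
  · intro y hy
    have hq : y.val.2 + τ < r y.val.1 := by
      rw [Ne, h.ret_iff hτc] at hy
      exact not_le.1 hy
    have e := h.up0 hp.le y hq
    constructor
    · unfold Dm
      rw [e]
      simp only [AddCircle.coe_add_period]
    · unfold jm
      rw [e]
      simp only
      rw [add_div, div_self hp.ne', Nat.floor_add_one (div_nonneg y.2.1 hp.le)]
  · intro y hy
    have hq := (h.ret_iff hτc y).1 hy
    have e := h.up1 hp.le hτc y hq
    unfold Dm skw
    rw [e]
    simp only [AddCircle.coe_sub, AddCircle.coe_add, AddCircle.coe_period, add_zero]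
    rw [sub_eq_add_neg]
  · intro y
    rw [h.ret_iff hτc]
    have hr := rep_coe (τ := τ) y.2.1
    have hlt := y.2.2
    have hn : nm τ r (Dm τ r y) = ⌈(r y.val.1 - y.val.2) / τ + jm τ r y⌉₊ - 1 := by
      unfold nm Dm
      simp only
      rw [hr]
      congr 2
      unfold jm
      field_simp
      ring
    rw [hn, Nat.ceil_add_natCast (div_nonneg (by linarith) hp.le)]
    have hpos : 0 < ⌈(r y.val.1 - y.val.2) / τ⌉₊ := Nat.ceil_pos.2 (div_pos (by linarith) hp)
    have : r y.val.1 ≤ y.val.2 + τ ↔ ⌈(r y.val.1 - y.val.2) / τ⌉₊ ≤ 1 := by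
      rw [Nat.ceil_le, Nat.cast_one, div_le_one hp, sub_le_iff_le_add, add_comm]
    rw [this]
    omega

/-- Inverse branches. -/
noncomputable def ebr (τ : ℝ) [Fact (0 < τ)] (h : SF T r c C Φ) (i : ℕ) (z : X × AddCircle τ) :
    Susp r :=
  ⟨(z.1, if rep z.2 + i * τ < r z.1 then rep z.2 + i * τ else 0), by
    have hp : 0 < τ := Fact.out
    have := rep_nonneg z.2
    dsimp only
    split_ifs with hh
    · exact ⟨by positivity, hh⟩
    · exact ⟨le_rfl, h.hc.trans_le (h.hb _).1⟩⟩

lemma abramov_small (h : SF T r c C Φ) (hτc : τ ≤ c) (ν : Measure X) [IsProbabilityMeasure ν]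
    (hν : MeasurePreserving T ν ν) :
    kolSinaiEntropy (suspensionMeasure ν r) (Φ τ) =
      ENNReal.ofReal (τ / ∫ x, r x ∂ν) * kolSinaiEntropy ν T := by
  have hp := hτ.out
  have hpr := h.susp_prob ν
  have ht := h.tower hτc ν hν
  have hmk : Measurable (fun s : ℝ => (s : AddCircle τ)) := AddCircle.measurable_mk'
  have hR := h.R_pos ν
  have hρ : Measurable fun x => -(r x : AddCircle τ) := (hmk.comp h.hr).neg
  rw [ht.kol_eq (Nat.succ_pos _) ENNReal.ofReal_ne_top (by simpa using div_pos hp hR) (ebr τ h),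
    kol_skew hν hρ]
  · intro i
    refine Measurable.subtype_mk (measurable_fst.prodMk ?_)
    have : Measurable fun z : X × AddCircle τ => rep z.2 + i * τ :=
      (rep_meas.comp measurable_snd).add_const _
    exact Measurable.ite (measurableSet_lt this (h.hr.comp measurable_fst)) this measurable_const
  · intro y
    have hr := rep_coe (τ := τ) y.2.1
    have e : rep (Dm τ r y).2 + jm τ r y * τ = y.val.2 := by
      unfold Dm jm
      simp only
      rw [hr]; ring
    apply Subtype.ext
    unfold ebr
    simp only
    rw [e]
    have : y.val.2 < r (Dm τ r y).1 := y.2.2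
    rw [if_pos this]
    rfl

end SF

/-- Abramov's formula. -/
lemma SF.abramov (h : SF T r c C Φ) (ν : Measure X) [IsProbabilityMeasure ν]
    (hν : MeasurePreserving T ν ν) :
    kolSinaiEntropy (suspensionMeasure ν r) (Φ 1) =
      ENNReal.ofReal (1 / ∫ x, r x ∂ν) * kolSinaiEntropy ν T := by
  obtain ⟨m, hm⟩ := exists_nat_gt (1 / c)
  have hc := h.hc
  have hm0 : (0 : ℝ) < m := lt_trans (by positivity) hm
  have hR := h.R_pos ν
  have hpr := h.susp_prob ν
  have : Fact ((0 : ℝ) < 1 / m) := ⟨by positivity⟩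
  have hle : 1 / (m : ℝ) ≤ c := by
    rw [div_lt_iff₀ hc] at hm
    rw [div_le_iff₀ hm0]
    linarith
  have e : Φ 1 = (Φ (1 / m))^[m] := by
    funext q
    rw [h.iter]
    congr 1
    field_simp
  rw [e, kol_pow (h.susp_inv hν _) (by exact_mod_cast hm0), h.abramov_small hle ν hν, ← mul_assoc]
  congr 1
  rw [← ENNReal.ofReal_natCast m, ← ENNReal.ofReal_mul hm0.le]
  congr 1
  field_simp

end flow

end Abr

set_option linter.unusedSectionVars false
set_option linter.unusedVariables false

namespace Abr
open Filter Topology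

section tms
variable {V : Type*} {A : V → V → Prop}

lemma coord_set (i : ℤ) (S : Set V) : MeasurableSet {x : TMS A | x.val i ∈ S} := by
  refine ⟨{y : ℤ → V | y i ∈ S}, ?_, rfl⟩
  let _ : MeasurableSpace V := ⊤
  exact measurable_pi_apply i trivial

lemma tms_meas {Ω : Type*} [MeasurableSpace Ω] {f : Ω → TMS A}
    (h : ∀ i (S : Set V), MeasurableSet {ω | (f ω).val i ∈ S}) : Measurable f := by
  let _ : MeasurableSpace V := ⊤
  rw [measurable_comap_iff]
  refine measurable_pi_lambda _ fun i => ?_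
  intro S _
  exact h i S

/-- The shift as a measurable equivalence. -/
def shiftE (A : V → V → Prop) : TMS A ≃ᵐ TMS A where
  toFun := TMS.shift
  invFun x := ⟨fun i => x.val (i - 1), fun i => by
    have := x.prop (i - 1)
    have e : i - 1 + 1 = i + 1 - 1 := by ring
    rwa [e] at this⟩
  left_inv x := Subtype.ext (by funext i; simp [TMS.shift])
  right_inv x := Subtype.ext (by funext i; simp [TMS.shift])
  measurable_toFun := tms_meas fun i S => coord_set (i + 1) S
  measurable_invFun := tms_meas fun i S => coord_set (i - 1) S

lemma shiftE_coe : ⇑(shiftE A) = TMS.shift := rfl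

/-- The agreement set on a window. -/
def win (N : ℕ) (x : TMS A) : Set (TMS A) := {y | ∀ i : ℤ, |i| ≤ (N : ℤ) → x.val i = y.val i}

lemma win_countable [Countable V] (N : ℕ) : (range (win (A := A) N)).Countable := by
  let g : (Finset.Icc (-(N : ℤ)) N → V) → Set (TMS A) := fun w => {y | ∀ i, w i = y.val i.1}
  refine (countable_range g).mono ?_
  rintro _ ⟨x, rfl⟩
  refine ⟨fun i => x.val i.1, ?_⟩
  ext y
  constructor
  · intro hy i hi
    exact hy ⟨i, Finset.mem_Icc.2 (abs_le.1 hi)⟩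
  · intro hy i
    exact hy i.1 (abs_le.2 (Finset.mem_Icc.1 i.2))

lemma win_meas (N : ℕ) (x : TMS A) : MeasurableSet (win N x) := by
  have : win N x = ⋂ i : ℤ, ⋂ (_ : |i| ≤ (N : ℤ)), {y : TMS A | y.val i ∈ ({x.val i} : Set V)} := by
    ext y; simp [win, eq_comm]
  rw [this]
  exact MeasurableSet.iInter fun i => MeasurableSet.iInter fun _ => coord_set i _

lemma holder_meas [Countable V] {g : TMS A → ℝ} (hg : TMSHolder g) : Measurable g := by
  obtain ⟨K, β, hβ, hK⟩ := hg
  refine measurable_of_Ioi fun a => ?_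
  have hlim : Tendsto (fun N : ℕ => K * Real.exp (-(β * ((N : ℝ) + 1)))) atTop (𝓝 (K * 0)) := by
    refine Tendsto.const_mul K (Real.tendsto_exp_neg_atTop_nhds_zero.comp ?_)
    exact (tendsto_natCast_atTop_atTop.atTop_add tendsto_const_nhds).const_mul_atTop hβ
  rw [mul_zero] at hlim
  have hopen : g ⁻¹' Ioi a = ⋃ N : ℕ, ⋃₀ {s ∈ range (win (A := A) N) | s ⊆ g ⁻¹' Ioi a} := by
    apply Subset.antisymm
    · intro x hx
      have hx' : 0 < g x - a := sub_pos.2 hx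
      obtain ⟨N, hN⟩ := (hlim.eventually (gt_mem_nhds hx')).exists
      refine mem_iUnion.2 ⟨N, mem_sUnion.2 ⟨win N x, ⟨⟨x, rfl⟩, ?_⟩, fun i _ => rfl⟩⟩
      intro y hy
      have := hK N x y hy
      have := (abs_le.1 this).2
      show a < g y
      linarith
    · refine iUnion_subset fun N => sUnion_subset ?_
      rintro s ⟨_, hs⟩
      exact hs
  rw [hopen]
  refine MeasurableSet.iUnion fun N => MeasurableSet.sUnion ?_ ?_
  · exact (win_countable N).mono fun s hs => hs.1
  · rintro s ⟨⟨x, rfl⟩, _⟩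
    exact win_meas N x

lemma cyl_meas {s : Set (TMS A)} (hs : IsFinUnionOfCylinders s) : MeasurableSet s := by
  obtain ⟨k, c, hc, rfl⟩ := hs
  refine MeasurableSet.iUnion fun i => ?_
  obtain ⟨m, n, w, e⟩ := hc i
  rw [e, ofPred_forall]
  exact MeasurableSet.iInter fun j => coord_set _ {w j}

end tms

section final
variable {X : Type*} [MeasurableSpace X]
variable {T : X ≃ᵐ X} {r : X → ℝ} {c C : ℝ} {Φ : ℝ → Susp r → Susp r}

namespace SF

lemma pressure_id (h : SF T r c C Φ) (ν : Measure X) [IsProbabilityMeasure ν]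
    (hν : MeasurePreserving T ν ν) {g : X × ℝ → ℝ} (hg : Measurable g) {K : ℝ}
    (hK : ∀ p, |g p| ≤ K) (P : ℝ) :
    realPressure ν T (fun x => (∫ s in (0 : ℝ)..(r x), g (x, s)) - P * r x) =
      (∫ x, r x ∂ν) * (flowRealPressure Φ (suspensionMeasure ν r) (fun q => g q.val) - P) := by
  have hR := h.R_pos ν
  obtain ⟨hi, he⟩ := h.susp_integral ν hg hK
  unfold realPressure flowRealPressure
  rw [he, h.abramov ν hν, ENNReal.toReal_mul, ENNReal.toReal_ofReal (by positivity),
    integral_sub hi ((h.r_int ν).const_mul P), integral_const_mul]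
  field_simp
  ring

variable (h : SF T r c C Φ)

lemma flow_le {g : Susp r → ℝ} (hb : BddAbove (flowPressureSet Φ g)) {μ : Measure (Susp r)}
    [hp : IsProbabilityMeasure μ] (hμ : FlowInvariant Φ μ) :
    flowRealPressure Φ μ g ≤ flowTopPressure Φ g :=
  le_csSup hb ⟨μ, hp, hμ, rfl⟩

lemma top_zero (h : SF T r c C Φ) {g : X × ℝ → ℝ} (hg : Measurable g) {K : ℝ}
    (hK : ∀ p, |g p| ≤ K) (hne : (flowPressureSet Φ (fun q : Susp r => g q.val)).Nonempty)
    (hb : BddAbove (flowPressureSet Φ (fun q : Susp r => g q.val))) :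
    topPressureMap T (fun x => (∫ s in (0 : ℝ)..(r x), g (x, s)) -
      flowTopPressure Φ (fun q : Susp r => g q.val) * r x) = 0 := by
  have hX : Nonempty X := by
    obtain ⟨_, μ, hp, -, -⟩ := hne
    obtain ⟨q⟩ := nonempty_of_isProbabilityMeasure μ
    exact ⟨q.val.1⟩
  have hC : 0 < C := h.hc.trans_le h.cC
  refine csSup_eq_of_forall_le_of_forall_lt_exists_gt ?_ ?_ ?_
  · obtain ⟨_, μ, hp, hμ, -⟩ := hne
    obtain ⟨ν, h1, h2, rfl⟩ := h.ambrose hμ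
    exact ⟨_, ν, h1, h2, rfl⟩
  · rintro _ ⟨ν, h1, h2, rfl⟩
    have hpr := h.susp_prob ν
    rw [h.pressure_id ν h2 hg hK]
    exact mul_nonpos_of_nonneg_of_nonpos (h.R_pos ν).le
      (sub_nonpos.2 (flow_le hb (h.susp_inv h2)))
  · intro w hw
    have : flowTopPressure Φ (fun q : Susp r => g q.val) + w / C <
        sSup (flowPressureSet Φ (fun q : Susp r => g q.val)) := by
      have : w / C < 0 := div_neg_of_neg_of_pos hw hC
      show _ < flowTopPressure Φ (fun q : Susp r => g q.val)
      linarith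
    obtain ⟨_, ⟨μ, hp, hμ, rfl⟩, hlt⟩ := exists_lt_of_lt_csSup hne this
    obtain ⟨ν, h1, h2, rfl⟩ := h.ambrose hμ
    refine ⟨_, ⟨ν, h1, h2, rfl⟩, ?_⟩
    rw [h.pressure_id ν h2 hg hK]
    have hle := flow_le hb hμ
    have hRC := h.R_le ν
    have a1 : w / C < flowRealPressure Φ (suspensionMeasure ν r) (fun q => g q.val) -
      flowTopPressure Φ (fun q : Susp r => g q.val) := by linarith
    rw [div_lt_iff₀ hC] at a1
    nlinarith

lemma gur_iff (h : SF T r c C Φ) [Nonempty X] :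
    flowGurevichEntropy Φ ≠ ⊤ ↔ gurevichEntropyMap T ≠ ⊤ := by
  have hC : 0 < C := h.hc.trans_le h.cC
  have hc := h.hc
  constructor
  · intro hf
    have : gurevichEntropyMap T ≤ ENNReal.ofReal C * flowGurevichEntropy Φ := by
      refine iSup_le fun ν => iSup_le fun h1 => iSup_le fun h2 => ?_
      have hpr := h.susp_prob ν
      have hR := h.R_pos ν
      have e : kolSinaiEntropy ν T = ENNReal.ofReal (∫ x, r x ∂ν) *
          kolSinaiEntropy (suspensionMeasure ν r) (Φ 1) := by
        rw [h.abramov ν h2, ← mul_assoc, ← ENNReal.ofReal_mul hR.le, mul_one_div_cancel hR.ne',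
          ENNReal.ofReal_one, one_mul]
      rw [e]
      gcongr
      · exact h.R_le ν
      · exact le_iSup_of_le (suspensionMeasure ν r) (le_iSup_of_le hpr
          (le_iSup_of_le (h.susp_inv h2) le_rfl))
    exact ne_top_of_le_ne_top (ENNReal.mul_ne_top ENNReal.ofReal_ne_top hf) this
  · intro hf
    have : flowGurevichEntropy Φ ≤ ENNReal.ofReal (1 / c) * gurevichEntropyMap T := by
      refine iSup_le fun μ => iSup_le fun h1 => iSup_le fun h2 => ?_
      obtain ⟨ν, n1, n2, rfl⟩ := h.ambrose h2
      rw [h.abramov ν n2]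
      gcongr
      · exact h.R_ge ν
      · exact le_iSup_of_le ν (le_iSup_of_le n1 (le_iSup_of_le n2 le_rfl))
    exact ne_top_of_le_ne_top (ENNReal.mul_ne_top ENNReal.ofReal_ne_top hf) this

end SF

end final

end Abr

/-- Let `(Σ_r, σ_r)` be a topological Markov flow with Hölder roof
function `r`, `0 < inf r ≤ sup r < ∞`, and let `ϑ` be a Hölder continuous potential
on `Σ_r` with finite top pressure.  Then `(Σ_r, σ_r)` is SPR for `ϑ` if and only if
the base shift `(Σ, σ)` is SPR for the induced potential
`Δ_ϑ - P_TOP(σ_r, ϑ) · r`, where `Δ_ϑ(x) = ∫₀^{r(x)} ϑ(x,s) ds`.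
The suspension flow `Φ` is specified by the flow laws and the characterization
`Φ_t(x,s) = (σ^n x, s + t - r_n(x))`, `r_n(x) ≤ s + t < r_{n+1}(x)`, for `t ≥ 0`. -/
theorem TMF_SPR_iff_base_SPR
    {V : Type*} [Countable V] (A : V → V → Prop) (hproper : IsProperGraph A)
    (r : TMS A → ℝ) (c C : ℝ) (hc : 0 < c) (hrb : ∀ x : TMS A, c ≤ r x ∧ r x ≤ C)
    (hrHolder : TMSHolder r)
    (ϑ : TMS A × ℝ → ℝ) (hϑmeas : Measurable ϑ)
    (hϑbdd : ∃ K₀ : ℝ, ∀ q : TMS A × ℝ, |ϑ q| ≤ K₀)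
    (hϑHolder : ∃ K β : ℝ, 0 < β ∧ ∀ (N : ℕ) (x y : TMS A) (s t : ℝ),
      (∀ i : ℤ, |i| ≤ (N : ℤ) → x.val i = y.val i) →
      |ϑ (x, s) - ϑ (y, t)| ≤ K * (Real.exp (-(β * ((N : ℝ) + 1))) + |s - t| ^ β))
    (Φ : ℝ → Susp r → Susp r)
    (hΦ0 : ∀ q : Susp r, Φ 0 q = q)
    (hΦadd : ∀ (s t : ℝ) (q : Susp r), Φ (s + t) q = Φ s (Φ t q))
    (hΦchar : ∀ t : ℝ, 0 ≤ t → ∀ q : Susp r, ∃ n : ℕ,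
      birkhoff TMS.shift r n q.val.1 ≤ q.val.2 + t ∧
      q.val.2 + t < birkhoff TMS.shift r (n + 1) q.val.1 ∧
      (Φ t q).val.1 = TMS.shift^[n] q.val.1 ∧
      (Φ t q).val.2 = q.val.2 + t - birkhoff TMS.shift r n q.val.1)
    (hPne : (flowPressureSet Φ (fun q : Susp r => ϑ q.val)).Nonempty)
    (hPbdd : BddAbove (flowPressureSet Φ (fun q : Susp r => ϑ q.val))) :
    FlowSPRFor r Φ (fun q : Susp r => ϑ q.val) ↔
      TMSisSPRFor A (fun x : TMS A =>
        (∫ s in (0 : ℝ)..(r x), ϑ (x, s)) -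
          flowTopPressure Φ (fun q : Susp r => ϑ q.val) * r x) := by
  have hrm : Measurable r := Abr.holder_meas hrHolder
  have h : Abr.SF (Abr.shiftE A) r c C Φ := ⟨hc, hrm, hrb, hΦ0, hΦadd, hΦchar⟩
  obtain ⟨K, hK⟩ := hϑbdd
  have hX : Nonempty (TMS A) := by
    obtain ⟨_, μ, hp, -, -⟩ := hPne
    obtain ⟨q⟩ := nonempty_of_isProbabilityMeasure μ
    exact ⟨q.val.1⟩
  have hC : 0 < C := hc.trans_le h.cC
  have htop := h.top_zero hϑmeas hK hPne hPbdd
  have hid := fun (ν : Measure (TMS A)) (hp : IsProbabilityMeasure ν)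
    (hν : MeasurePreserving (TMS.shift : TMS A → TMS A) ν ν) =>
    h.pressure_id ν hν hϑmeas hK (flowTopPressure Φ (fun q : Susp r => ϑ q.val))
  have hgur := h.gur_iff
  simp only [Abr.shiftE_coe] at htop hid hgur
  unfold FlowSPRFor TMSisSPRFor
  rw [hgur, htop]
  refine and_congr_right fun _ => ?_
  constructor
  · rintro ⟨Cs, hCs, P0, τ, hP0, hτ, hall⟩
    refine ⟨Cs, hCs, c * (P0 - flowTopPressure Φ (fun q : Susp r => ϑ q.val)), τ * c / C, ?_,
      by positivity, ?_⟩
    · exact mul_neg_of_pos_of_neg hc (sub_neg.2 hP0)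
    · intro ν hp he hlt
      have hpr := h.susp_prob ν
      have hinv := he.toMeasurePreserving
      rw [hid ν hp hinv] at hlt
      have hle := Abr.SF.flow_le hPbdd (h.susp_inv (ν := ν) hinv)
      have hR := h.R_ge ν
      have h1 : P0 < flowRealPressure Φ (suspensionMeasure ν r) (fun q : Susp r => ϑ q.val) := by
        by_contra hcon
        rw [not_lt] at hcon
        nlinarith
      have h2 := hall _ hpr (h.susp_erg he) h1
      by_contra hcon
      rw [not_lt] at hcon
      have h3 := h.base_le ν (Abr.cyl_meas hCs)
      have h4 : ENNReal.ofReal (C / c) * ν Cs ≤ ENNReal.ofReal τ := by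
        calc ENNReal.ofReal (C / c) * ν Cs ≤ ENNReal.ofReal (C / c) * ENNReal.ofReal (τ * c / C) := by
              gcongr
          _ = ENNReal.ofReal τ := by
              rw [← ENNReal.ofReal_mul (by positivity)]
              congr 1
              field_simp
      exact absurd (h2.trans_le (h3.trans h4)) (lt_irrefl _)
  · rintro ⟨Cs, hCs, P0, τ, hP0, hτ, hall⟩
    refine ⟨Cs, hCs, flowTopPressure Φ (fun q : Susp r => ϑ q.val) + P0 / C, c / C * τ, ?_,
      by positivity, ?_⟩
    · have := div_neg_of_neg_of_pos hP0 hC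
      linarith
    · intro μ hp he hlt
      obtain ⟨ν, n1, n2, rfl⟩ := h.ambrose he.1
      have hle := Abr.SF.flow_le hPbdd he.1
      have hRC := h.R_le ν
      have h1 : P0 < realPressure ν TMS.shift (fun x : TMS A =>
          (∫ s in (0 : ℝ)..(r x), ϑ (x, s)) -
          flowTopPressure Φ (fun q : Susp r => ϑ q.val) * r x) := by
        rw [hid ν n1 n2]
        have a1 : P0 / C < flowRealPressure Φ (suspensionMeasure ν r) (fun q : Susp r => ϑ q.val) -
          flowTopPressure Φ (fun q : Susp r => ϑ q.val) := by linarith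
        rw [div_lt_iff₀ hC] at a1
        nlinarith
      have h2 := hall ν n1 (h.base_erg n2 he) h1
      refine lt_of_lt_of_le ?_ (h.le_base ν (Abr.cyl_meas hCs))
      rw [ENNReal.ofReal_mul (by positivity)]
      have hcC : ENNReal.ofReal (c / C) ≠ 0 := by
        simpa using div_pos hc hC
      exact (ENNReal.mul_lt_mul_iff_right hcC ENNReal.ofReal_ne_top).2 h2
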